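/- arXiv:1701.08639 — 4 statements merged into one kernel-verified Lean document; each statement's English description precedes it below -/
import Mathlib

section
/- For every β ≥ 0, every integer d ≥ 3 and every B > 0, the function B′ ↦ ψ(β,B′) is differentiable at B and its derivative equals 2t* − 1, where t* is the unique solution in (1/2,1) of the equation log((1−t)/t) − d·log f(β,1−t) + 2B = 0. -/
open Filter MeasureTheory

/-- `f(β,t) = (c(1−2t) + √(1+(c²−1)(1−2t)²))/(2(1−t))` with `c = exp(−2β)`. -/
noncomputable def fIsing (β t : ℝ) : ℝ :=
  (Real.exp (-2*β) * (1 - 2*t) +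
    Real.sqrt (1 + (Real.exp (-2*β)^2 - 1) * (1 - 2*t)^2)) / (2*(1-t))

/-- `F(β,t) = ∫₀^{min(t,1−t)} log f(β,s) ds`. -/
noncomputable def FIsing (β t : ℝ) : ℝ :=
  ∫ s in (0:ℝ)..(min t (1-t)), Real.log (fIsing β s)

/-- Auxiliary recursion for `g(β,·,m)` on `0 ≤ k ≤ ⌊m/2⌋`. -/
noncomputable def gAux (β : ℝ) (m : ℕ) : ℕ → ℝ
  | 0 => 1
  | 1 => Real.exp (-2*β)
  | (k+2) => (((m:ℝ) - 2*((k:ℝ)+2) + 2) * Real.exp (-2*β) / ((m:ℝ) - ((k:ℝ)+2) + 1)) *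
        gAux β m (k+1)
      + (((k:ℝ)+1) / ((m:ℝ) - ((k:ℝ)+2) + 1)) * gAux β m k

/-- `g(β,k,m) = E[exp(−2β X(k,m))]`, given by the recursion together with the
symmetry `g(β,k,m) = g(β,m−k,m)`. -/
noncomputable def gIsing (β : ℝ) (k m : ℕ) : ℝ :=
  if k ≤ m/2 then gAux β m k else gAux β m (m - k)

/-- `I(t) = (t−1)log(1−t) − t log t` (with `I(0)=I(1)=0` via `Real.log 0 = 0`). -/
noncomputable def IIsing (t : ℝ) : ℝ := (t-1) * Real.log (1-t) - t * Real.log t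

/-- `H(t) = I(t) + d F(β,t)`. -/
noncomputable def HIsing (β : ℝ) (d : ℕ) (t : ℝ) : ℝ := IIsing t + d * FIsing β t

/-- `L(t) = H(t) + 2Bt`. -/
noncomputable def LIsing (β B : ℝ) (d : ℕ) (t : ℝ) : ℝ := HIsing β d t + 2*B*t

/-- The annealed pressure `ψ(β,B) = βd/2 − B + max_{0≤t≤1} L(t)`. -/
noncomputable def psiIsing (β B : ℝ) (d : ℕ) : ℝ :=
  β*(d:ℝ)/2 - B + sSup ((LIsing β B d) '' Set.Icc (0:ℝ) 1)

/-- The (unnormalized) annealed weight of having `j` plus spins: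
`x_j = C(n,j) e^{2Bj} g(β,dj,dn)`. -/
noncomputable def xw (β B : ℝ) (d n j : ℕ) : ℝ :=
  (n.choose j : ℝ) * Real.exp (2*B*(j:ℝ)) * gIsing β (d*j) (d*n)

/-- The stationarity function in the hyperbolic coordinate. -/
noncomputable def Kfun (β B : ℝ) (d : ℕ) (y : ℝ) : ℝ :=
  ((d:ℝ) - 2) * y - d * Real.arsinh (Real.exp (-2*β) * Real.sinh y) + 2*B

/-- The stationarity function in the original coordinate. -/
noncomputable def Gfun (β B : ℝ) (d : ℕ) (t : ℝ) : ℝ :=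
  Real.log ((1-t)/t) - (d:ℝ) * Real.log (fIsing β (1-t)) + 2*B

lemma exp_neg_le_one {β : ℝ} (hβ : 0 ≤ β) : Real.exp (-2*β) ≤ 1 := by
  rw [Real.exp_le_one_iff]; linarith

lemma convex_arsinh (c : ℝ) (hc : 0 < c) (hc1 : c ≤ 1) :
    ConvexOn ℝ (Set.Ici (0:ℝ)) (fun y => Real.arsinh (c * Real.sinh y)) := by
  have hder : ∀ y : ℝ, HasDerivAt (fun y => Real.arsinh (c * Real.sinh y))
      ((Real.sqrt (1 + (c * Real.sinh y)^2))⁻¹ * (c * Real.cosh y)) y := by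
    intro y
    have := ((Real.hasDerivAt_sinh y).const_mul c).arsinh
    simpa [smul_eq_mul] using this
  apply MonotoneOn.convexOn_of_deriv (convex_Ici 0)
  · exact fun y _ => (hder y).continuousAt.continuousWithinAt
  · exact fun y _ => (hder y).differentiableAt.differentiableWithinAt
  · intro x hx y hy hxy
    rw [interior_Ici] at hx hy
    have hx0 : 0 < x := hx
    rw [(hder x).deriv, (hder y).deriv]
    have px : 0 < 1 + (c * Real.sinh x)^2 := by positivity
    have py : 0 < 1 + (c * Real.sinh y)^2 := by positivity
    rw [inv_mul_eq_div, inv_mul_eq_div, div_le_div_iff₀ (Real.sqrt_pos.2 px) (Real.sqrt_pos.2 py)]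
    apply le_of_sq_le_sq _ (by positivity)
    simp only [mul_pow] at px py ⊢
    rw [Real.sq_sqrt px.le, Real.sq_sqrt py.le, Real.cosh_sq, Real.cosh_sq]
    have hs : Real.sinh x ^ 2 ≤ Real.sinh y ^ 2 := by
      have h0 : 0 ≤ Real.sinh x := Real.sinh_nonneg_iff.2 hx0.le
      have h1 : Real.sinh x ≤ Real.sinh y := Real.sinh_le_sinh.2 hxy
      gcongr
    have hc2 : c^2 ≤ 1 := by nlinarith
    have : 0 ≤ c^2 * ((1 - c^2) * (Real.sinh y ^ 2 - Real.sinh x ^ 2)) :=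
      mul_nonneg (sq_nonneg _) (mul_nonneg (by linarith) (by linarith))
    nlinarith

lemma Kfun_concave (β B : ℝ) (hβ : 0 ≤ β) (d : ℕ) :
    ConcaveOn ℝ (Set.Ici (0:ℝ)) (Kfun β B d) := by
  have h := convex_arsinh (Real.exp (-2*β)) (Real.exp_pos _) (exp_neg_le_one hβ)
  refine ⟨convex_Ici 0, ?_⟩
  intro x hx y hy a b ha hb hab
  have h2 := h.2 hx hy ha hb hab
  simp only [smul_eq_mul, Kfun] at h2 ⊢
  have hd : (0:ℝ) ≤ d := Nat.cast_nonneg d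
  have h3 := mul_le_mul_of_nonneg_left h2 hd
  have h4 : a * (2*B) + b * (2*B) = 2 * B := by rw [← add_mul, hab, one_mul]
  nlinarith

lemma Kfun_zero (β B : ℝ) (d : ℕ) : Kfun β B d 0 = 2*B := by simp [Kfun]

lemma Kfun_continuous (β B : ℝ) (d : ℕ) : Continuous (Kfun β B d) := by
  unfold Kfun
  have := Real.continuous_sinh
  have h2 := Real.continuous_arsinh.comp ((continuous_const (y := Real.exp (-2*β))).mul this)
  exact ((continuous_const.mul continuous_id).sub (continuous_const.mul h2)).add continuous_const

lemma Kfun_le (β B : ℝ) (hβ : 0 ≤ β) (d : ℕ) (y : ℝ) :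
    Kfun β B d y ≤ -2*y + 2*(d*β) + 2*B := by
  have h : y - 2*β ≤ Real.arsinh (Real.exp (-2*β) * Real.sinh y) := by
    rw [← Real.exp_le_exp, Real.exp_arsinh]
    have h1 : Real.exp (-2*β) * Real.cosh y
        ≤ Real.sqrt (1 + (Real.exp (-2*β) * Real.sinh y)^2) := by
      apply Real.le_sqrt_of_sq_le
      rw [mul_pow, mul_pow, Real.cosh_sq]
      have := exp_neg_le_one hβ
      have h0 := Real.exp_pos (-2*β)
      nlinarith
    have h2 : Real.exp (y - 2*β) = Real.exp (-2*β) * Real.sinh y + Real.exp (-2*β) * Real.cosh y := by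
      rw [← mul_add, Real.sinh_add_cosh, ← Real.exp_add]; ring_nf
    linarith
  have hd : (0:ℝ) ≤ d := Nat.cast_nonneg d
  have := mul_le_mul_of_nonneg_left h hd
  unfold Kfun
  nlinarith

lemma Kfun_root (β B : ℝ) (hβ : 0 ≤ β) (hB : 0 < B) (d : ℕ) :
    ∃ y0, 0 < y0 ∧ Kfun β B d y0 = 0 ∧ (∀ y, 0 < y → y < y0 → 0 < Kfun β B d y) ∧
      (∀ y, y0 < y → Kfun β B d y < 0) := by
  have hM : (0:ℝ) ≤ d*β + B + 1 := by positivity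
  have hneg : Kfun β B d (d*β + B + 1) ≤ 0 := by
    have := Kfun_le β B hβ d (d*β + B + 1); linarith
  have hpos : 0 ≤ Kfun β B d 0 := by rw [Kfun_zero]; linarith
  obtain ⟨y0, hy0, hK⟩ := intermediate_value_Icc' hM (Kfun_continuous β B d).continuousOn
    (⟨hneg, hpos⟩ : (0:ℝ) ∈ Set.Icc _ _)
  have hy0p : 0 < y0 := by
    rcases hy0.1.eq_or_lt with h | h
    · rw [← h, Kfun_zero] at hK; linarith
    · exact h
  have gen : ∀ a b, 0 < a → a < b → 0 ≤ Kfun β B d b → 0 < Kfun β B d a := by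
    intro a b ha hab hb
    have hbp : 0 < b := ha.trans hab
    have h := (Kfun_concave β B hβ d).2 (Set.mem_Ici.2 (le_refl (0:ℝ))) (Set.mem_Ici.2 hbp.le)
      (show 0 ≤ 1 - a/b by rw [sub_nonneg, div_le_one hbp]; exact hab.le)
      (show 0 ≤ a/b by positivity) (by ring)
    simp only [smul_eq_mul, mul_zero, zero_add, div_mul_cancel₀ _ hbp.ne', Kfun_zero] at h
    have h1 : 0 < 1 - a/b := by rw [sub_pos, div_lt_one hbp]; exact hab
    have : 0 ≤ a/b * Kfun β B d b := by positivity
    have : 0 < (1 - a/b) * (2*B) := by positivity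
    linarith
  refine ⟨y0, hy0p, hK, fun y h1 h2 => gen y y0 h1 h2 hK.ge, fun y h => ?_⟩
  by_contra! hc
  have := gen y0 y hy0p h hc
  linarith

/-- the hyperbolic coordinate -/
noncomputable def ycoord (t : ℝ) : ℝ := Real.log (t/(1-t)) / 2

lemma fIsing_ycoord (β t : ℝ) (ht : t ∈ Set.Ioo (0:ℝ) 1) :
    fIsing β (1-t) =
      Real.exp (Real.arsinh (Real.exp (-2*β) * Real.sinh (ycoord t)) - ycoord t) := by
  obtain ⟨h0, h1⟩ := ht
  have h1' : 0 < 1 - t := by linarith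
  set y := ycoord t with hy
  set c := Real.exp (-2*β)
  have hE : Real.exp y ^ 2 = t/(1-t) := by
    rw [← Real.exp_nat_mul, hy, ycoord]
    push_cast
    rw [mul_div_cancel₀ _ (two_ne_zero), Real.exp_log (by positivity)]
  have hEp := Real.exp_pos y
  set E := Real.exp y with hEdef
  have hts : t = E^2/(E^2+1) := by
    rw [hE]; field_simp; ring
  have hC : Real.cosh y = (E + E⁻¹)/2 := by rw [Real.cosh_eq, Real.exp_neg]
  have hS : Real.sinh y = (E - E⁻¹)/2 := by rw [Real.sinh_eq, Real.exp_neg]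
  have hw : 1 - 2*(1-t) = Real.sinh y / Real.cosh y := by
    rw [hC, hS, hts]; field_simp; ring
  have hCp := Real.cosh_pos y
  have hsq : Real.sqrt (1 + (c^2 - 1) * (1 - 2*(1-t))^2)
      = Real.sqrt (1 + (c * Real.sinh y)^2) / Real.cosh y := by
    rw [hw, ← Real.sqrt_sq hCp.le, ← Real.sqrt_div (by positivity), Real.sqrt_sq hCp.le]
    congr 1
    have := Real.cosh_sq y
    field_simp
    rw [this]; ring
  unfold fIsing
  rw [hsq, hw, Real.exp_sub, Real.exp_arsinh]
  have h2 : 2 * (1 - (1-t)) = E / Real.cosh y := by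
    rw [hC, hts]; field_simp; ring
  rw [h2, ← mul_div_assoc, ← add_div, div_div_div_cancel_right₀ hCp.ne']

lemma Gfun_eq (β B : ℝ) (d : ℕ) (t : ℝ) (ht : t ∈ Set.Ioo (0:ℝ) 1) :
    Gfun β B d t = Kfun β B d (ycoord t) := by
  unfold Gfun Kfun
  rw [fIsing_ycoord β t ht, Real.log_exp]
  have : Real.log ((1-t)/t) = -2 * ycoord t := by
    rw [ycoord, ← inv_div, Real.log_inv]; ring
  rw [this]; ring

lemma ycoord_lt {s t : ℝ} (hs : 0 < s) (hst : s < t) (ht : t < 1) : ycoord s < ycoord t := by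
  unfold ycoord
  have h1 : 0 < 1 - t := by linarith
  have h2 : 0 < 1 - s := by linarith
  have : Real.log (s/(1-s)) < Real.log (t/(1-t)) := by
    apply Real.log_lt_log (by positivity)
    rw [div_lt_div_iff₀ h2 h1]; nlinarith
  linarith

lemma ycoord_half : ycoord (1/2) = 0 := by
  unfold ycoord; norm_num

lemma Gfun_root (β B : ℝ) (hβ : 0 ≤ β) (hB : 0 < B) (d : ℕ) :
    ∃ T ∈ Set.Ioo (1/2:ℝ) 1, Gfun β B d T = 0 ∧
      (∀ t ∈ Set.Ioo (1/2:ℝ) T, 0 < Gfun β B d t) ∧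
      (∀ t ∈ Set.Ioo T 1, Gfun β B d t < 0) := by
  obtain ⟨y0, hy0, hK, hp, hn⟩ := Kfun_root β B hβ hB d
  have he : 1 < Real.exp (2*y0) := by rw [Real.one_lt_exp_iff]; linarith
  set T := Real.exp (2*y0) / (Real.exp (2*y0) + 1) with hT
  have hT1 : T < 1 := by rw [hT, div_lt_one (by positivity)]; linarith
  have hT2 : 1/2 < T := by rw [hT, lt_div_iff₀ (by positivity)]; linarith
  have hyT : ycoord T = y0 := by
    have : T/(1-T) = Real.exp (2*y0) := by
      rw [hT]; field_simp; ring
    rw [ycoord, this, Real.log_exp]; ring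
  refine ⟨T, ⟨hT2, hT1⟩, ?_, ?_, ?_⟩
  · rw [Gfun_eq _ _ _ _ ⟨by linarith, hT1⟩, hyT, hK]
  · rintro t ⟨h1, h2⟩
    rw [Gfun_eq _ _ _ _ ⟨by linarith, by linarith⟩]
    apply hp
    · rw [← ycoord_half]; exact ycoord_lt (by norm_num) h1 (by linarith)
    · rw [← hyT]; exact ycoord_lt (by linarith) h2 hT1
  · rintro t ⟨h1, h2⟩
    rw [Gfun_eq _ _ _ _ ⟨by linarith, by linarith⟩]
    apply hn
    rw [← hyT]; exact ycoord_lt (by linarith) h1 h2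

lemma fIsing_pos (β s : ℝ) (hs : s ∈ Set.Icc (0:ℝ) (1/2)) : 0 < fIsing β s := by
  obtain ⟨h0, h1⟩ := hs
  unfold fIsing
  have hc := Real.exp_pos (-2*β)
  set c := Real.exp (-2*β)
  have h2 : 0 < 1 + (c^2-1)*(1-2*s)^2 := by
    rcases h0.eq_or_lt with h | h
    · rw [← h]; norm_num; positivity
    · have : (1-2*s)^2 < 1 := by nlinarith
      nlinarith [mul_nonneg (sq_nonneg c) (sq_nonneg (1-2*s))]
  apply div_pos _ (by linarith)
  have := Real.sqrt_pos.2 h2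
  have : 0 ≤ c * (1-2*s) := mul_nonneg hc.le (by linarith)
  linarith

lemma logf_cont (β : ℝ) : ContinuousOn (fun s => Real.log (fIsing β s)) (Set.Icc (0:ℝ) (1/2)) := by
  apply ContinuousOn.log
  · unfold fIsing
    apply ContinuousOn.div
    · fun_prop
    · fun_prop
    · intro s hs
      have := hs.2
      intro h
      linarith
  · exact fun s hs => (fIsing_pos β s hs).ne'

lemma FIsing_symm (β t : ℝ) : FIsing β (1-t) = FIsing β t := by
  unfold FIsing; rw [sub_sub_cancel, min_comm]

lemma HIsing_symm (β t : ℝ) (d : ℕ) : HIsing β d (1-t) = HIsing β d t := by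
  unfold HIsing; rw [FIsing_symm]; unfold IIsing; rw [sub_sub_cancel]; ring

lemma FIsing_eq (β t : ℝ) (ht : 1/2 ≤ t) :
    FIsing β t = ∫ s in (0:ℝ)..(1-t), Real.log (fIsing β s) := by
  unfold FIsing; rw [min_eq_right (by linarith)]

lemma FIsing_cont (β : ℝ) : ContinuousOn (FIsing β) (Set.Icc (1/2:ℝ) 1) := by
  have h := intervalIntegral.continuousOn_primitive_interval
    (f := fun s => Real.log (fIsing β s)) (μ := volume) (a := 0) (b := 1/2)
    (by rw [Set.uIcc_of_le (by norm_num)]; exact (logf_cont β).integrableOn_Icc)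
  rw [Set.uIcc_of_le (by norm_num)] at h
  have h2 : ContinuousOn (fun t : ℝ => ∫ s in (0:ℝ)..(1-t), Real.log (fIsing β s))
      (Set.Icc (1/2:ℝ) 1) := by
    refine h.comp (f := fun t : ℝ => 1 - t) (s := Set.Icc (1/2:ℝ) 1) (by fun_prop) ?_
    intro t ht
    constructor <;> simp only <;> linarith [ht.1, ht.2]
  exact h2.congr fun t ht => FIsing_eq β t ht.1

lemma FIsing_deriv (β t : ℝ) (ht : t ∈ Set.Ioo (1/2:ℝ) 1) :
    HasDerivAt (FIsing β) (-Real.log (fIsing β (1-t))) t := by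
  obtain ⟨h1, h2⟩ := ht
  have hc := logf_cont β
  have hnhds : Set.Icc (0:ℝ) (1/2) ∈ nhds (1-t) := Icc_mem_nhds (by linarith) (by linarith)
  have hint : IntervalIntegrable (fun s => Real.log (fIsing β s)) volume 0 (1-t) := by
    apply ContinuousOn.intervalIntegrable
    apply hc.mono
    rw [Set.uIcc_of_le (by linarith)]
    exact Set.Icc_subset_Icc le_rfl (by linarith)
  have hF := intervalIntegral.integral_hasDerivAt_right hint
    (hc.stronglyMeasurableAtFilter_nhdsWithin measurableSet_Icc (1-t) |>.filter_mono
      (by rw [nhdsWithin_eq_nhds.2 hnhds]))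
    (hc.continuousAt hnhds)
  have hcomp := hF.comp t ((hasDerivAt_id t).const_sub 1)
  have : (-Real.log (fIsing β (1-t))) = Real.log (fIsing β (1-t)) * (-1) := by ring
  rw [this]
  refine hcomp.congr_of_eventuallyEq ?_
  filter_upwards [Ioi_mem_nhds h1] with u hu
  exact FIsing_eq β u (le_of_lt hu)

lemma IIsing_eq (t : ℝ) : IIsing t = Real.binEntropy t := by
  rw [Real.binEntropy_eq_negMulLog_add_negMulLog_one_sub]
  unfold IIsing Real.negMulLog; ring

lemma LIsing_cont (β B : ℝ) (d : ℕ) : ContinuousOn (LIsing β B d) (Set.Icc (1/2:ℝ) 1) := by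
  have h : Continuous IIsing := by
    rw [funext IIsing_eq]; exact Real.binEntropy_continuous
  exact (h.continuousOn.add (continuousOn_const.mul (FIsing_cont β))).add (by fun_prop)

lemma LIsing_deriv (β B : ℝ) (d : ℕ) (t : ℝ) (ht : t ∈ Set.Ioo (1/2:ℝ) 1) :
    HasDerivAt (LIsing β B d) (Gfun β B d t) t := by
  have h0 : t ≠ 0 := by linarith [ht.1]
  have h1 : t ≠ 1 := ht.2.ne
  have hI : HasDerivAt IIsing (Real.log (1-t) - Real.log t) t := by
    rw [funext IIsing_eq]; exact Real.hasDerivAt_binEntropy h0 h1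
  have h := (hI.add ((FIsing_deriv β t ht).const_mul (d:ℝ))).add
    ((hasDerivAt_id t).const_mul (2*B))
  have e : Gfun β B d t = Real.log (1-t) - Real.log t +
      (d:ℝ) * (-Real.log (fIsing β (1-t))) + 2*B*1 := by
    unfold Gfun
    rw [Real.log_div (sub_ne_zero.2 h1.symm) h0]; ring
  rw [e]
  exact h

lemma LIsing_max (β B : ℝ) (hB : 0 < B) (d : ℕ) (T : ℝ) (hT : T ∈ Set.Ioo (1/2:ℝ) 1)
    (hp : ∀ t ∈ Set.Ioo (1/2:ℝ) T, 0 < Gfun β B d t)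
    (hn : ∀ t ∈ Set.Ioo T 1, Gfun β B d t < 0) :
    ∀ t ∈ Set.Icc (0:ℝ) 1, LIsing β B d t ≤ LIsing β B d T := by
  have hc := LIsing_cont β B d
  have key : ∀ t ∈ Set.Icc (1/2:ℝ) 1, LIsing β B d t ≤ LIsing β B d T := by
    intro t ht
    rcases le_total t T with h | h
    · have hm : StrictMonoOn (LIsing β B d) (Set.Icc (1/2:ℝ) T) := by
        apply strictMonoOn_of_deriv_pos (convex_Icc _ _)
        · exact hc.mono (Set.Icc_subset_Icc le_rfl hT.2.le)
        · intro x hx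
          rw [interior_Icc] at hx
          rw [(LIsing_deriv β B d x ⟨hx.1, hx.2.trans hT.2⟩).deriv]
          exact hp x hx
      exact hm.monotoneOn ⟨ht.1, h⟩ ⟨hT.1.le, le_rfl⟩ h
    · have hm : StrictAntiOn (LIsing β B d) (Set.Icc T 1) := by
        apply strictAntiOn_of_deriv_neg (convex_Icc _ _)
        · exact hc.mono (Set.Icc_subset_Icc hT.1.le le_rfl)
        · intro x hx
          rw [interior_Icc] at hx
          rw [(LIsing_deriv β B d x ⟨hT.1.trans hx.1, hx.2⟩).deriv]
          exact hn x hx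
      exact hm.antitoneOn ⟨le_rfl, hT.2.le⟩ ⟨h, ht.2⟩ h
  intro t ht
  rcases le_total (1/2) t with h | h
  · exact key t ⟨h, ht.2⟩
  · have h1 := key (1-t) ⟨by linarith, by linarith [ht.1]⟩
    have h2 : LIsing β B d t ≤ LIsing β B d (1-t) := by
      unfold LIsing; rw [HIsing_symm]
      nlinarith
    exact h2.trans h1

lemma psi_eq (β B : ℝ) (d : ℕ) (T : ℝ) (hT : T ∈ Set.Icc (0:ℝ) 1)
    (hm : ∀ t ∈ Set.Icc (0:ℝ) 1, LIsing β B d t ≤ LIsing β B d T) :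
    psiIsing β B d = β*(d:ℝ)/2 - B + LIsing β B d T := by
  unfold psiIsing
  have : IsGreatest ((LIsing β B d) '' Set.Icc (0:ℝ) 1) (LIsing β B d T) := by
    refine ⟨⟨T, hT, rfl⟩, ?_⟩
    rintro _ ⟨t, ht, rfl⟩
    exact hm t ht
  rw [this.csSup_eq]

lemma Gfun_shift (β B B' : ℝ) (d : ℕ) (t : ℝ) :
    Gfun β B' d t = Gfun β B d t + 2*(B'-B) := by
  unfold Gfun; ring

/-- differentiability of the annealed pressure in `B > 0`, with
derivative `2t* − 1` where `t*` is the unique solution in `(1/2,1)` of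
`log((1−t)/t) − d log f(β,1−t) + 2B = 0`. -/
theorem annealed_pressure_hasDerivAt (β B : ℝ) (hβ : 0 ≤ β) (d : ℕ) (hd : 3 ≤ d)
    (hB : 0 < B) :
    ∃ tstar : ℝ, tstar ∈ Set.Ioo (1/2 : ℝ) 1 ∧
      Real.log ((1-tstar)/tstar) - (d:ℝ) * Real.log (fIsing β (1-tstar)) + 2*B = 0 ∧
      (∀ t ∈ Set.Ioo (1/2 : ℝ) 1,
        Real.log ((1-t)/t) - (d:ℝ) * Real.log (fIsing β (1-t)) + 2*B = 0 → t = tstar) ∧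
      HasDerivAt (fun B' => psiIsing β B' d) (2*tstar - 1) B := by
  obtain ⟨T, hT, hT0, hp, hn⟩ := Gfun_root β B hβ hB d
  refine ⟨T, hT, hT0, ?_, ?_⟩
  · intro t ht h
    change Gfun β B d t = 0 at h
    rcases lt_trichotomy t T with h1 | h1 | h1
    · have := hp t ⟨ht.1, h1⟩; linarith
    · exact h1
    · have := hn t ⟨h1, ht.2⟩; linarith
  have hmax := LIsing_max β B hB d T hT hp hn
  have hTI : T ∈ Set.Icc (0:ℝ) 1 := ⟨by linarith [hT.1], hT.2.le⟩
  rw [hasDerivAt_iff_isLittleO, Asymptotics.isLittleO_iff]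
  intro ε hε
  -- points on both sides of `T`
  obtain ⟨a, ha1, ha2⟩ : ∃ a, max (1/2) (T - ε/2) < a ∧ a < T :=
    exists_between (max_lt hT.1 (by linarith))
  obtain ⟨b, hb1, hb2⟩ : ∃ b, T < b ∧ b < min 1 (T + ε/2) :=
    exists_between (lt_min hT.2 (by linarith))
  have ha3 : 1/2 < a := (le_max_left _ _).trans_lt ha1
  have ha4 : T - ε/2 < a := (le_max_right _ _).trans_lt ha1
  have hb3 : b < 1 := hb2.trans_le (min_le_left _ _)
  have hb4 : b < T + ε/2 := hb2.trans_le (min_le_right _ _)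
  have hGa := hp a ⟨ha3, ha2⟩
  have hGb := hn b ⟨hb1, hb3⟩
  filter_upwards [Ioi_mem_nhds hB,
    Ioi_mem_nhds (show B - Gfun β B d a / 2 < B by linarith),
    Iio_mem_nhds (show B < B - Gfun β B d b / 2 by linarith)] with B' h1 h2 h3
  simp only [Set.mem_Ioi, Set.mem_Iio] at h1 h2 h3
  obtain ⟨T', hT', hT0', hp', hn'⟩ := Gfun_root β B' hβ h1 d
  have hmax' := LIsing_max β B' h1 d T' hT' hp' hn'
  have hTI' : T' ∈ Set.Icc (0:ℝ) 1 := ⟨by linarith [hT'.1], hT'.2.le⟩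
  have haT : a ≤ T' := by
    by_contra! h
    have := hn' a ⟨h, by linarith⟩
    rw [Gfun_shift β B B'] at this; linarith
  have hbT : T' ≤ b := by
    by_contra! h
    have := hp' b ⟨by linarith, h⟩
    rw [Gfun_shift β B B'] at this; linarith
  rw [psi_eq β B' d T' hTI' hmax', psi_eq β B d T hTI hmax]
  have e1 := hmax T' hTI'
  have e2 := hmax' T hTI
  unfold LIsing at *
  simp only [smul_eq_mul, Real.norm_eq_abs]
  set h := B' - B with hh
  have hB' : B' = B + h := by rw [hh]; ring
  clear_value h
  subst hB'
  have l1 : 0 ≤ (HIsing β d T' + 2*(B+h)*T') - (HIsing β d T + 2*B*T) - 2*h*T := by linarith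
  have l2 : (HIsing β d T' + 2*(B+h)*T') - (HIsing β d T + 2*B*T) - 2*h*T ≤ h*(2*(T'-T)) := by
    linarith
  have l3 : h*(2*(T'-T)) ≤ ε * |h| := by
    have : |2*(T'-T)| ≤ ε := by rw [abs_le]; constructor <;> linarith
    calc h*(2*(T'-T)) ≤ |h*(2*(T'-T))| := le_abs_self _
      _ = |2*(T'-T)| * |h| := by rw [abs_mul, mul_comm]
      _ ≤ ε * |h| := by gcongr
  rw [abs_le]
  constructor <;> nlinarith
end

section
/- Let d ≥ 3 be an integer. For β > 0 let M(β,0⁺) denote the limit as B decreases to 0 of ∂_B ψ(β,B) (the derivative exists for every B > 0). Then the critical inverse temperature β_c := inf{ β > 0 : M(β,0⁺) exists and is strictly positive } satisfies β_c = atanh(1/(d−1)) = (1/2)·log(d/(d−2)). -/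
open Filter MeasureTheory

/-- The inverse hyperbolic tangent: `artanh x = (1/2) log((1+x)/(1−x))`. -/
noncomputable def artanh (x : ℝ) : ℝ := (1/2) * Real.log ((1+x)/(1-x))


/-! ### The auxiliary function `k` -/

noncomputable def kAux (c D x : ℝ) : ℝ :=
  Real.log (1 - c*x) - Real.log (x - c) + (D-1) * Real.log x

noncomputable def QAux (c D x : ℝ) : ℝ := (D-1)*(1-c*x)*(x-c) - (1-c^2)*x

lemma kAux_one (c D : ℝ) : kAux c D 1 = 0 := by simp [kAux]

lemma kAux_hasDeriv {c D x : ℝ} (hc : 0 < c) (hc1 : c < 1) (hx : c < x) (hx1 : x ≤ 1) :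
    HasDerivAt (kAux c D) (QAux c D x / (x*(1-c*x)*(x-c))) x := by
  have hx0 : 0 < x := hc.trans hx
  have h1 : 0 < 1 - c*x := by nlinarith
  have h2 : 0 < x - c := by linarith
  have e1 : HasDerivAt (fun x : ℝ => 1 - c*x) (-c) x := by
    simpa using ((hasDerivAt_id x).const_mul c).const_sub 1
  have e2 : HasDerivAt (fun x : ℝ => x - c) 1 x := (hasDerivAt_id x).sub_const c
  have := ((e1.log h1.ne').sub (e2.log h2.ne')).add
    ((Real.hasDerivAt_log hx0.ne').const_mul (D-1))
  refine this.congr_deriv ?_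
  unfold QAux
  field_simp
  ring

lemma kAux_cont {c D : ℝ} (hc : 0 < c) (hc1 : c < 1) {a b : ℝ} (ha : c < a) (hb : b ≤ 1) :
    ContinuousOn (kAux c D) (Set.Icc a b) := fun x hx =>
  (kAux_hasDeriv hc hc1 (ha.trans_le hx.1) (hx.2.trans hb)).continuousAt.continuousWithinAt

lemma kAux_mvt {c D : ℝ} (hc : 0 < c) (hc1 : c < 1) {a b : ℝ} (ha : c < a) (hab : a < b)
    (hb : b ≤ 1) : ∃ ξ ∈ Set.Ioo a b, ∃ p > 0, kAux c D b - kAux c D a = p * QAux c D ξ := by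
  obtain ⟨ξ, hξ, h⟩ := exists_hasDerivAt_eq_slope (kAux c D)
    (fun x => QAux c D x / (x*(1-c*x)*(x-c))) hab (kAux_cont hc hc1 ha hb)
    (fun _ hx => kAux_hasDeriv hc hc1 (ha.trans hx.1) (hx.2.le.trans hb))
  have hx : c < ξ := ha.trans hξ.1
  have hx1 : ξ < 1 := hξ.2.trans_le hb
  have hx0 : 0 < ξ := hc.trans hx
  have h1 : 0 < 1 - c*ξ := by nlinarith
  have h2 : 0 < ξ - c := by linarith
  have h3 : 0 < b - a := by linarith
  refine ⟨ξ, hξ, (b-a)/(ξ*(1-c*ξ)*(ξ-c)), by positivity, ?_⟩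
  have : kAux c D b - kAux c D a = (b-a) * ((kAux c D b - kAux c D a)/(b-a)) := by
    field_simp
  rw [this, ← h]
  ring

lemma QAux_one (c D : ℝ) : QAux c D 1 = (1-c)*(D-2-D*c) := by unfold QAux; ring

lemma QAux_neg {c D x : ℝ} (hc : 0 < c) (hD : 3 ≤ D) (hx : 0 < x) 
    (h : QAux c D 1 < 0) : QAux c D x < 0 := by
  have e : QAux c D x = x * QAux c D 1 - (D-1)*c*(x-1)^2 := by unfold QAux; ring
  have : 0 ≤ (D-1)*c*(x-1)^2 := by
    have : 0 ≤ D - 1 := by linarith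
    positivity
  nlinarith

lemma QAux_pos {c D x y : ℝ} (hc : 0 < c) (hD : 3 ≤ D) (hxy : x < y) (hy : y < 1)
    (hx : 0 ≤ QAux c D x) (h : 0 < QAux c D 1) : 0 < QAux c D y := by
  have e : (1-x) * QAux c D y = (1-y) * QAux c D x + (y-x) * QAux c D 1
      + (D-1)*c*((y-x)*(1-y)*(1-x)) := by unfold QAux; ring
  have h1 : 0 < 1 - x := by linarith
  have h2 : 0 < 1 - y := by linarith
  have h3 : 0 < y - x := by linarith
  have h4 : 0 < D - 1 := by linarith
  have : 0 < (1-x) * QAux c D y := by rw [e]; positivity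
  exact (pos_iff_pos_of_mul_pos this).1 h1

lemma kAux_quasi {c D : ℝ} (hc : 0 < c) (hc1 : c < 1) (hD : 3 ≤ D) (hne : D*c ≠ D-2)
    {a b v : ℝ} (ha : c < a) (hab : a < b) (hb : b < 1) (hv : 0 ≤ v) (h : kAux c D a ≤ v) :
    kAux c D b < v := by
  by_contra hcon
  push Not at hcon
  obtain ⟨x, hx, p, hp, e1⟩ := kAux_mvt (D := D) hc hc1 ha hab hb.le
  obtain ⟨y, hy, q, hq, e2⟩ := kAux_mvt (D := D) hc hc1 (ha.trans hab) hb le_rfl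
  rw [kAux_one] at e2
  have h1 : 0 ≤ QAux c D x := by
    have : 0 ≤ p * QAux c D x := by linarith
    exact nonneg_of_mul_nonneg_right this hp
  have h2 : QAux c D y ≤ 0 := by
    by_contra hh
    push Not at hh
    have := mul_pos hq hh
    linarith
  have h3 : QAux c D 1 ≠ 0 := by
    rw [QAux_one]
    exact mul_ne_zero (by linarith) (fun hh => hne (by linarith))
  rcases lt_or_gt_of_ne h3 with h3 | h3
  · exact absurd (QAux_neg hc hD (by linarith [hx.1]) h3) (not_lt.2 h1)
  · exact absurd (QAux_pos hc hD (hx.2.trans hy.1) hy.2 h1 h3) (not_lt.2 h2)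

lemma kAux_pos {c D : ℝ} (hc : 0 < c) (hc1 : c < 1) (hD : 3 ≤ D) (hlt : D - 2 < D*c)
    {a : ℝ} (ha : c < a) (h1 : a < 1) : 0 < kAux c D a := by
  obtain ⟨x, hx, p, hp, e1⟩ := kAux_mvt (D := D) hc hc1 ha h1 le_rfl
  rw [kAux_one] at e1
  have h3 : QAux c D 1 < 0 := by
    rw [QAux_one]
    exact mul_neg_of_pos_of_neg (by linarith) (by linarith)
  have hx0 : 0 < x := by linarith [hx.1]
  have := mul_neg_of_pos_of_neg hp (QAux_neg hc hD hx0 h3)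
  linarith

lemma kAux_neg {c D : ℝ} (hc : 0 < c) (hc1 : c < 1) (hlt : D*c < D - 2) :
    ∃ a₀, a₀ < 1 ∧ ∀ a, c < a → a₀ < a → a < 1 → kAux c D a < 0 := by
  have h3 : 0 < QAux c D 1 := by
    rw [QAux_one]
    exact mul_pos (by linarith) (by linarith)
  have hcont : Continuous (QAux c D) := by unfold QAux; fun_prop
  have hev : ∀ᶠ x in nhds (1:ℝ), 0 < QAux c D x :=
    hcont.continuousAt.eventually (lt_mem_nhds h3)
  obtain ⟨ε, hε, hball⟩ := Metric.eventually_nhds_iff.1 hev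
  refine ⟨1 - ε, by linarith, fun a ha h0 h1 => ?_⟩
  obtain ⟨x, hx, p, hp, e1⟩ := kAux_mvt (D := D) hc hc1 ha h1 le_rfl
  rw [kAux_one] at e1
  have hQ : 0 < QAux c D x := by
    apply hball
    rw [Real.dist_eq, abs_lt]
    constructor <;> linarith [hx.1, hx.2]
  have := mul_pos hp hQ
  linarith

/-! ### Facts on `f` -/

lemma c_pos (β : ℝ) : 0 < Real.exp (-2*β) := Real.exp_pos _

lemma c_lt {β : ℝ} (hβ : 0 < β) : Real.exp (-2*β) < 1 := by
  rw [Real.exp_lt_one_iff]; linarith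

lemma rad_eq (c t : ℝ) : 1 + (c^2 - 1) * (1 - 2*t)^2 = c^2*(1-2*t)^2 + 4*t*(1-t) := by ring

lemma rad_pos {c t : ℝ} (hc : 0 < c) (h0 : 0 ≤ t) (h1 : t ≤ 1/2) :
    0 < 1 + (c^2 - 1) * (1 - 2*t)^2 := by
  rw [rad_eq]
  rcases h0.eq_or_lt with h | h
  · subst h; simp; positivity
  · have : 0 < 1 - t := by linarith
    positivity

lemma f_pos {β t : ℝ} (h0 : 0 ≤ t) (h1 : t ≤ 1/2) : 0 < fIsing β t := by
  unfold fIsing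
  have h2 : 0 < 1 - t := by linarith
  have h3 : 0 ≤ 1 - 2*t := by linarith
  have h4 := Real.sqrt_pos.2 (rad_pos (c_pos β) h0 h1)
  have h5 := c_pos β
  positivity

lemma f_quad {β t : ℝ} (h0 : 0 ≤ t) (h1 : t ≤ 1/2) :
    (1-t) * fIsing β t ^2 - Real.exp (-2*β)*(1-2*t) * fIsing β t - t = 0 := by
  have h2 : 1 - t ≠ 0 := by linarith
  have h4 := Real.sq_sqrt (rad_pos (c_pos β) h0 h1).le
  unfold fIsing
  set c := Real.exp (-2*β)
  set r := Real.sqrt (1 + (c^2 - 1) * (1 - 2*t)^2)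
  field_simp
  linear_combination h4

lemma f_mem {β t : ℝ} (hβ : 0 < β) (h0 : 0 < t) (h1 : t < 1/2) :
    Real.exp (-2*β) < fIsing β t ∧ fIsing β t < 1 := by
  have hq := f_quad (β := β) h0.le h1.le
  have hf := f_pos (β := β) h0.le h1.le
  have hc := c_pos β
  have hc1 := c_lt hβ
  set c := Real.exp (-2*β)
  set f := fIsing β t
  constructor
  · by_contra hcon
    have e : (f - c)*((1-t)*f+c*t) = t*(1-c^2) := by linear_combination hq
    have : 0 < t*(1-c^2) := mul_pos h0 (by nlinarith)
    have h2 : 0 < (1-t)*f+c*t := by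
      have : 0 < 1 - t := by linarith
      positivity
    nlinarith
  · by_contra hcon
    have e : (f - 1)*((1-t)*(f+1)-c*(1-2*t)) = -((1-2*t)*(1-c)) := by linear_combination hq
    have : 0 < (1-2*t)*(1-c) := mul_pos (by linarith) (by linarith)
    have h2 : 0 < (1-t)*(f+1)-c*(1-2*t) := by nlinarith
    nlinarith

lemma f_half (β : ℝ) : fIsing β (1/2) = 1 := by
  unfold fIsing; norm_num

lemma f_mono {β s t : ℝ} (hβ : 0 < β) (h0 : 0 < s) (hst : s < t) (h1 : t < 1/2) :
    fIsing β s < fIsing β t := by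
  have hq := f_quad (β := β) h0.le (hst.trans h1).le
  have hq' := f_quad (β := β) (h0.trans hst).le h1.le
  obtain ⟨a, b⟩ := f_mem hβ h0 (hst.trans h1)
  obtain ⟨a2, b2⟩ := f_mem hβ (h0.trans hst) h1
  have hc := c_pos β
  have hc1 := c_lt hβ
  set c := Real.exp (-2*β)
  set f := fIsing β s
  set g := fIsing β t
  by_contra hcon
  push Not at hcon
  -- `p_t(f) < 0 = p_t(g)` where `p_t` increases beyond `g`
  have e : (f-g)*((1-t)*(f+g) - c*(1-2*t)) = (s-t)*(f^2 - 2*c*f + 1) := by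
    linear_combination hq - hq'
  have h2 : 0 < (1-t)*(f+g) - c*(1-2*t) := by nlinarith
  have h3 : 0 < f^2 - 2*c*f+1 := by nlinarith [sq_nonneg (f-c)]
  nlinarith [mul_nonneg (sub_nonneg.2 hcon) h2.le]

lemma f_contOn (β : ℝ) : ContinuousOn (fIsing β) (Set.Iio 1) := by
  unfold fIsing
  apply ContinuousOn.div
  · fun_prop
  · fun_prop
  · intro x hx; simp at hx; intro h; linarith

lemma logf_contOn (β : ℝ) : ContinuousOn (fun s => Real.log (fIsing β s)) (Set.Icc 0 (1/2)) := by
  apply ContinuousOn.log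
  · exact (f_contOn β).mono (fun x hx => by simp at hx ⊢; linarith)
  · intro x hx; exact (f_pos hx.1 hx.2).ne'

/-! ### Facts on `H` -/

lemma II_eq : IIsing = Real.binEntropy := by
  funext t; simp [IIsing, Real.binEntropy]; ring

lemma H_symm (β : ℝ) (d : ℕ) (t : ℝ) : HIsing β d (1-t) = HIsing β d t := by
  unfold HIsing
  rw [II_eq, Real.binEntropy_one_sub]
  unfold FIsing
  rw [sub_sub_cancel, min_comm]

lemma F_eq (β : ℝ) {t : ℝ} (h : t ≤ 1/2) :
    FIsing β t = ∫ s in (0:ℝ)..t, Real.log (fIsing β s) := by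
  unfold FIsing; rw [min_eq_left (by linarith)]

lemma H_cont (β : ℝ) (d : ℕ) : ContinuousOn (HIsing β d) (Set.Icc 0 (1/2)) := by
  unfold HIsing
  rw [II_eq]
  apply (Real.binEntropy_continuous.continuousOn).add
  apply continuousOn_const.mul
  have : ContinuousOn (fun t => ∫ s in (0:ℝ)..t, Real.log (fIsing β s)) (Set.Icc 0 (1/2)) := by
    have h := intervalIntegral.continuousOn_primitive_interval (μ := volume)
      (f := fun s => Real.log (fIsing β s)) (a := 0) (b := 1/2)
    rw [Set.uIcc_of_le (by norm_num)] at h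
    exact h ((logf_contOn β).integrableOn_Icc)
  exact this.congr (fun t ht => F_eq β ht.2)

lemma h_eq {β t : ℝ} (d : ℕ) (hβ : 0 < β) (h0 : 0 < t) (h1 : t < 1/2) :
    Real.log (1-t) - Real.log t + d * Real.log (fIsing β t)
      = kAux (Real.exp (-2*β)) d (fIsing β t) := by
  have hq := f_quad (β := β) h0.le h1.le
  obtain ⟨a, b⟩ := f_mem hβ h0 h1
  have hf := f_pos (β := β) h0.le h1.le
  have hc := c_pos β
  have hc1 := c_lt hβ
  set c := Real.exp (-2*β)
  set f := fIsing β t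
  have e : (1-t) * (f * (f-c)) = t * (1-c*f) := by linear_combination hq
  have h2 : 1 - c*f ≠ 0 := by nlinarith
  have h3 : f - c ≠ 0 := by linarith
  have h4 : 1 - t ≠ 0 := by linarith
  have := congrArg Real.log e
  rw [Real.log_mul h4 (mul_ne_zero hf.ne' h3), Real.log_mul hf.ne' h3,
    Real.log_mul h0.ne' h2] at this
  unfold kAux
  linear_combination this

lemma H_deriv {β t : ℝ} (d : ℕ) (hβ : 0 < β) (h0 : 0 < t) (h1 : t < 1/2) :
    HasDerivAt (HIsing β d) (kAux (Real.exp (-2*β)) d (fIsing β t)) t := by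
  rw [← h_eq d hβ h0 h1]
  unfold HIsing
  rw [II_eq]
  apply (Real.hasDerivAt_binEntropy h0.ne' (by linarith)).add
  apply HasDerivAt.const_mul
  have hI : Set.Icc (0:ℝ) (1/2) ∈ nhds t := Icc_mem_nhds h0 h1
  have : HasDerivAt (fun t => ∫ s in (0:ℝ)..t, Real.log (fIsing β s))
      (Real.log (fIsing β t)) t := by
    apply intervalIntegral.integral_hasDerivAt_right
    · apply ContinuousOn.intervalIntegrable
      apply (logf_contOn β).mono
      rw [Set.uIcc_of_le h0.le]
      exact Set.Icc_subset_Icc_right h1.le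
    · refine ⟨_, hI, ?_⟩
      exact (logf_contOn β).aestronglyMeasurable measurableSet_Icc
    · exact (logf_contOn β).continuousAt hI
  refine this.congr_of_eventuallyEq ?_
  filter_upwards [hI] with x hx
  exact F_eq β hx.2

/-- tilted function -/
noncomputable def GT (β : ℝ) (d : ℕ) (B s : ℝ) : ℝ := HIsing β d s - 2*B*s

lemma GT_cont (β : ℝ) (d : ℕ) (B : ℝ) : ContinuousOn (GT β d B) (Set.Icc 0 (1/2)) := by
  unfold GT
  exact (H_cont β d).sub (by fun_prop)

lemma GT_mvt {β : ℝ} (d : ℕ) (hβ : 0 < β) (B : ℝ) {a b : ℝ} (ha : 0 ≤ a) (hab : a < b)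
    (hb : b ≤ 1/2) : ∃ ξ ∈ Set.Ioo a b, GT β d B b - GT β d B a
      = (b-a) * (kAux (Real.exp (-2*β)) d (fIsing β ξ) - 2*B) := by
  obtain ⟨ξ, hξ, h⟩ := exists_hasDerivAt_eq_slope (GT β d B)
    (fun x => kAux (Real.exp (-2*β)) d (fIsing β x) - 2*B) hab
    ((GT_cont β d B).mono (Set.Icc_subset_Icc ha hb))
    (fun x hx => by
      have := (H_deriv d hβ (ha.trans_lt hx.1) (hx.2.trans_le hb)).sub
        ((hasDerivAt_id x).const_mul (2*B))
      exact (this.congr_deriv (by simp)).congr_of_eventuallyEq (by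
        filter_upwards with y
        simp [GT]))
  refine ⟨ξ, hξ, ?_⟩
  have h3 : b - a ≠ 0 := by linarith
  rw [h]; field_simp

def IsMx (β : ℝ) (d : ℕ) (B s : ℝ) : Prop :=
  s ∈ Set.Icc (0:ℝ) (1/2) ∧ ∀ x ∈ Set.Icc (0:ℝ) (1/2), GT β d B x ≤ GT β d B s

lemma exists_mx (β : ℝ) (d : ℕ) (B : ℝ) : ∃ s, IsMx β d B s := by
  obtain ⟨s, hs, h⟩ := isCompact_Icc.exists_isMaxOn (Set.nonempty_Icc.2 (by norm_num))
    (GT_cont β d B)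
  exact ⟨s, hs, fun x hx => h hx⟩

lemma mx_unique_aux {β : ℝ} {d : ℕ} (hβ : 0 < β) (hd : 3 ≤ d)
    (hne : (d:ℝ) * Real.exp (-2*β) ≠ d - 2) {B : ℝ} (hB : 0 ≤ B) {a b : ℝ}
    (ha : IsMx β d B a) (hb : IsMx β d B b) (hab : a < b) : False := by
  have hD : (3:ℝ) ≤ d := by exact_mod_cast hd
  obtain ⟨x, hx, e⟩ := GT_mvt d hβ B ha.1.1 hab hb.1.2
  have hk : kAux (Real.exp (-2*β)) d (fIsing β x) - 2*B = 0 := by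
    have h1 := ha.2 b hb.1
    have h2 := hb.2 a ha.1
    have h3 : b - a ≠ 0 := by linarith
    have : (b-a) * (kAux (Real.exp (-2*β)) d (fIsing β x) - 2*B) = 0 := by linarith
    exact (mul_eq_zero.1 this).resolve_left h3
  have hx0 : 0 < x := ha.1.1.trans_lt hx.1
  obtain ⟨y, hy, e2⟩ := GT_mvt d hβ B hx0.le hx.2 hb.1.2
  have hy1 : y < 1/2 := hy.2.trans_le hb.1.2
  have h4 := kAux_quasi (c_pos β) (c_lt hβ) hD hne (f_mem hβ hx0 (hy.1.trans hy1)).1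
    (f_mono hβ hx0 hy.1 hy1) (f_mem hβ (hx0.trans hy.1) hy1).2
    (v := 2*B) (by linarith) (by linarith)
  have h5 := hb.2 x ⟨hx0.le, (hx.2.le.trans hb.1.2)⟩
  have h6 : 0 < b - x := by linarith [hx.2]
  nlinarith

lemma mx_unique {β : ℝ} {d : ℕ} (hβ : 0 < β) (hd : 3 ≤ d)
    (hne : (d:ℝ) * Real.exp (-2*β) ≠ d - 2) {B : ℝ} (hB : 0 ≤ B) {a b : ℝ}
    (ha : IsMx β d B a) (hb : IsMx β d B b) : a = b := by
  rcases lt_trichotomy a b with h | h | h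
  · exact (mx_unique_aux hβ hd hne hB ha hb h).elim
  · exact h
  · exact (mx_unique_aux hβ hd hne hB hb ha h).elim

lemma mx_zero_high {β : ℝ} {d : ℕ} (hβ : 0 < β) (hd : 3 ≤ d)
    (hlt : (d:ℝ) - 2 < d * Real.exp (-2*β)) {a : ℝ} (ha : IsMx β d 0 a) : a = 1/2 := by
  have hD : (3:ℝ) ≤ d := by exact_mod_cast hd
  by_contra hne
  have h := lt_of_le_of_ne ha.1.2 hne
  obtain ⟨x, hx, e⟩ := GT_mvt d hβ 0 ha.1.1 h le_rfl
  obtain ⟨p, q⟩ := f_mem hβ (ha.1.1.trans_lt hx.1) hx.2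
  have h1 := kAux_pos (c_pos β) (c_lt hβ) hD hlt p q
  have h2 := ha.2 (1/2) (by norm_num)
  have h3 : 0 < 1/2 - a := by linarith
  nlinarith

lemma mx_zero_low {β : ℝ} {d : ℕ} (hβ : 0 < β)
    (hlt : (d:ℝ) * Real.exp (-2*β) < d - 2) {a : ℝ} (ha : IsMx β d 0 a) : a < 1/2 := by
  refine lt_of_le_of_ne ha.1.2 (fun hne => ?_)
  obtain ⟨a₀, ha₀, hk⟩ := kAux_neg (c_pos β) (c_lt hβ) hlt
  have hev : ∀ᶠ x in nhds (1/2:ℝ), a₀ < fIsing β x := by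
    have : ContinuousAt (fIsing β) (1/2) := (f_contOn β).continuousAt (Iio_mem_nhds (by norm_num))
    apply this.eventually (lt_mem_nhds _)
    rw [f_half]; exact ha₀
  obtain ⟨ε, hε, hball⟩ := Metric.eventually_nhds_iff.1 hev
  set s := max 0 (1/2 - ε) with hs
  have hs0 : 0 ≤ s := le_max_left _ _
  have hs1 : s < 1/2 := max_lt (by norm_num) (by linarith)
  obtain ⟨x, hx, e⟩ := GT_mvt d hβ 0 hs0 hs1 le_rfl
  obtain ⟨p, q⟩ := f_mem hβ (hs0.trans_lt hx.1) hx.2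
  have h1 := hk _ p (hball (by
    rw [Real.dist_eq, abs_lt]
    have : 1/2 - ε ≤ s := le_max_right _ _
    constructor <;> linarith [hx.1, hx.2])) q
  have h2 := ha.2 s ⟨hs0, hs1.le⟩
  rw [hne] at h2
  have h3 : 0 < 1/2 - s := by linarith
  nlinarith

lemma mx_tendsto {β : ℝ} {d : ℕ} {σ : ℝ → ℝ} (hσ : ∀ B, IsMx β d B (σ B)) {B₀ : ℝ}
    (huniq : ∀ a, IsMx β d B₀ a → a = σ B₀) : Tendsto σ (nhds B₀) (nhds (σ B₀)) := by
  rw [Metric.tendsto_nhds]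
  intro ε hε
  set K := Set.Icc (0:ℝ) (1/2) ∩ {x | ε ≤ dist x (σ B₀)} with hK
  have hKc : IsCompact K := isCompact_Icc.inter_right
    (isClosed_le continuous_const (by fun_prop))
  by_cases hne : K.Nonempty
  · obtain ⟨x₁, hx₁, hmax⟩ := hKc.exists_isMaxOn hne
      ((GT_cont β d B₀).mono Set.inter_subset_left)
    have hlt : GT β d B₀ x₁ < GT β d B₀ (σ B₀) := by
      refine lt_of_le_of_ne ((hσ B₀).2 x₁ hx₁.1) (fun h => ?_)
      have := huniq x₁ ⟨hx₁.1, fun x hx => h ▸ (hσ B₀).2 x hx⟩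
      have h2 : ε ≤ dist x₁ (σ B₀) := hx₁.2
      rw [this, dist_self] at h2
      linarith
    filter_upwards [Metric.ball_mem_nhds B₀ (sub_pos.2 hlt)] with B hB
    by_contra hcon
    have hm : GT β d B₀ (σ B) ≤ GT β d B₀ x₁ := hmax ⟨(hσ B).1, not_lt.1 hcon⟩
    have h1 := (hσ B).2 (σ B₀) (hσ B₀).1
    rw [Metric.mem_ball, Real.dist_eq, abs_lt] at hB
    unfold GT at *
    have a1 := (hσ B).1.1
    have a2 := (hσ B).1.2
    have b1 := (hσ B₀).1.1
    have b2 := (hσ B₀).1.2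
    have key : 2*(B-B₀)*(σ B₀ - σ B) ≤ |B - B₀| := by
      calc 2*(B-B₀)*(σ B₀ - σ B) ≤ |2*(B-B₀)*(σ B₀ - σ B)| := le_abs_self _
        _ = |B-B₀| * (2*|σ B₀ - σ B|) := by rw [abs_mul, abs_mul, abs_two]; ring
        _ ≤ |B-B₀| * 1 := by
          apply mul_le_mul_of_nonneg_left _ (abs_nonneg _)
          have : |σ B₀ - σ B| ≤ 1/2 := abs_le.2 ⟨by linarith, by linarith⟩
          linarith
        _ = _ := mul_one _
    have := abs_lt.2 hB
    nlinarith
  · refine Eventually.of_forall (fun B => ?_)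
    by_contra hcon
    exact hne ⟨σ B, (hσ B).1, not_lt.1 hcon⟩

lemma psi_eq_s2 {β B : ℝ} {d : ℕ} (hB : 0 ≤ B) {s : ℝ} (hs : IsMx β d B s) :
    psiIsing β B d = β*(d:ℝ)/2 + B + GT β d B s := by
  have : IsGreatest (LIsing β B d '' Set.Icc (0:ℝ) 1) (2*B + GT β d B s) := by
    constructor
    · refine ⟨1 - s, ⟨by linarith [hs.1.2], by linarith [hs.1.1]⟩, ?_⟩
      unfold LIsing GT
      rw [H_symm]; ring
    · rintro _ ⟨t, ht, rfl⟩
      rcases le_total t (1/2) with h | h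
      · have := hs.2 t ⟨ht.1, h⟩
        unfold LIsing
        unfold GT at *
        nlinarith
      · have := hs.2 (1-t) ⟨by linarith [ht.2], by linarith⟩
        unfold LIsing
        unfold GT at *
        rw [H_symm] at this
        linarith
  unfold psiIsing
  rw [this.csSup_eq]; ring

lemma env {β : ℝ} {d : ℕ} {σ : ℝ → ℝ} (hσ : ∀ B, IsMx β d B (σ B)) {B₀ : ℝ} (hB₀ : 0 < B₀)
    (ht : Tendsto σ (nhds B₀) (nhds (σ B₀))) :
    HasDerivAt (fun B => psiIsing β B d) (1 - 2 * σ B₀) B₀ := by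
  have h1 : HasDerivAt (fun B => GT β d B (σ B)) (-(2 * σ B₀)) B₀ := by
    rw [hasDerivAt_iff_isLittleO, Asymptotics.isLittleO_iff]
    intro ε hε
    filter_upwards [ht (Metric.ball_mem_nhds (σ B₀) (half_pos hε))] with B hB
    have hB : |σ B - σ B₀| < ε/2 := hB
    have p := (hσ B).2 (σ B₀) (hσ B₀).1
    have q := (hσ B₀).2 (σ B) (hσ B).1
    unfold GT at *
    rw [smul_eq_mul, Real.norm_eq_abs, Real.norm_eq_abs]
    have hm : |(B-B₀)*(σ B - σ B₀)| ≤ |B-B₀| * (ε/2) := by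
      rw [abs_mul]; exact mul_le_mul_of_nonneg_left hB.le (abs_nonneg _)
    have hm' := abs_le.1 hm
    have : 0 ≤ |B - B₀| * ε := by positivity
    rw [abs_le]
    constructor <;> nlinarith
  have h2 : HasDerivAt (fun B => β*(d:ℝ)/2 + B + GT β d B (σ B)) (1 + -(2 * σ B₀)) B₀ :=
    ((hasDerivAt_id B₀).const_add _).add h1
  rw [← sub_eq_add_neg] at h2
  refine h2.congr_of_eventuallyEq ?_
  filter_upwards [Ioi_mem_nhds hB₀] with B hB
  exact psi_eq_s2 (le_of_lt hB) (hσ B)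

lemma main_limit {β : ℝ} {d : ℕ} (hβ : 0 < β) (hd : 3 ≤ d)
    (hne : (d:ℝ) * Real.exp (-2*β) ≠ d - 2) : ∃ s, IsMx β d 0 s ∧
    Tendsto (fun B => deriv (fun B' => psiIsing β B' d) B)
      (nhdsWithin 0 (Set.Ioi 0)) (nhds (1 - 2*s)) := by
  choose σ hσ using exists_mx β d
  have ht : ∀ B, 0 ≤ B → Tendsto σ (nhds B) (nhds (σ B)) := fun B hB =>
    mx_tendsto hσ (fun a ha => mx_unique hβ hd hne hB ha (hσ B))
  refine ⟨σ 0, hσ 0, ?_⟩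
  have h : Tendsto (fun B => 1 - 2 * σ B) (nhdsWithin 0 (Set.Ioi 0)) (nhds (1 - 2 * σ 0)) :=
    (((ht 0 le_rfl).mono_left nhdsWithin_le_nhds).const_mul 2).const_sub 1
  refine h.congr' ?_
  filter_upwards [self_mem_nhdsWithin] with B hB
  exact (env hσ hB (ht B (le_of_lt hB))).deriv.symm

lemma artanh_val (d : ℕ) (hd : 3 ≤ d) :
    artanh (1/((d:ℝ)-1)) = (1/2) * Real.log ((d:ℝ)/((d:ℝ)-2)) := by
  have hD : (3:ℝ) ≤ d := by exact_mod_cast hd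
  have h1 : (d:ℝ) - 1 ≠ 0 := by linarith
  have h2 : (d:ℝ) - 2 ≠ 0 := by linarith
  unfold artanh
  congr 2
  have e1 : 1 + 1/((d:ℝ)-1) = d/((d:ℝ)-1) := by field_simp; ring
  have e2 : 1 - 1/((d:ℝ)-1) = ((d:ℝ)-2)/((d:ℝ)-1) := by field_simp; ring
  rw [e1, e2, div_div_div_cancel_right₀ h1]

lemma lt_crit {d : ℕ} (hd : 3 ≤ d) (β : ℝ) :
    (β < (1/2) * Real.log ((d:ℝ)/((d:ℝ)-2)) ↔ (d:ℝ) - 2 < d * Real.exp (-2*β)) ∧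
    ((1/2) * Real.log ((d:ℝ)/((d:ℝ)-2)) < β ↔ d * Real.exp (-2*β) < (d:ℝ) - 2) := by
  have hD : (3:ℝ) ≤ d := by exact_mod_cast hd
  have h1 : 0 < (d:ℝ) := by linarith
  have h2 : 0 < (d:ℝ) - 2 := by linarith
  have h3 : 0 < d * Real.exp (-2*β) := by positivity
  have e := Real.log_div h1.ne' h2.ne'
  have e2 : Real.log (d * Real.exp (-2*β)) = Real.log d - 2*β := by
    rw [Real.log_mul h1.ne' (Real.exp_pos _).ne', Real.log_exp]; ring
  rw [← Real.log_lt_log_iff h2 h3, ← Real.log_lt_log_iff h3 h2, e, e2]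
  constructor <;> constructor <;> intro h <;> linarith

/-- the critical inverse temperature of the annealed Ising model on the
random `d`-regular graph is `atanh(1/(d−1)) = (1/2) log(d/(d−2))`. -/
theorem annealed_critical_temperature (d : ℕ) (hd : 3 ≤ d) :
    sInf {β : ℝ | 0 < β ∧ ∃ M : ℝ, 0 < M ∧
        Filter.Tendsto (fun B => deriv (fun B' => psiIsing β B' d) B)
          (nhdsWithin 0 (Set.Ioi 0)) (nhds M)}
      = artanh (1/((d:ℝ)-1))
    ∧ artanh (1/((d:ℝ)-1)) = (1/2) * Real.log ((d:ℝ)/((d:ℝ)-2)) := by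
  refine ⟨?_, artanh_val d hd⟩
  rw [artanh_val d hd]
  have hD : (3:ℝ) ≤ d := by exact_mod_cast hd
  have hpos : 0 < (1/2) * Real.log ((d:ℝ)/((d:ℝ)-2)) := by
    have : 1 < (d:ℝ)/((d:ℝ)-2) := by
      rw [lt_div_iff₀ (by linarith)]; linarith
    have := Real.log_pos this
    positivity
  have hin : ∀ β, (1/2) * Real.log ((d:ℝ)/((d:ℝ)-2)) < β → 
      β ∈ {β : ℝ | 0 < β ∧ ∃ M : ℝ, 0 < M ∧
        Filter.Tendsto (fun B => deriv (fun B' => psiIsing β B' d) B)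
          (nhdsWithin 0 (Set.Ioi 0)) (nhds M)} := by
    intro β hb
    have hlt := (lt_crit hd β).2.1 hb
    have hβ := hpos.trans hb
    obtain ⟨s, hs, ht⟩ := main_limit hβ hd hlt.ne
    have := mx_zero_low hβ hlt hs
    exact ⟨hβ, 1 - 2*s, by linarith, ht⟩
  apply csInf_eq_of_forall_ge_of_forall_gt_exists_lt
  · exact ⟨_, hin _ (lt_add_one _)⟩
  · rintro β ⟨hβ, M, hM, hT⟩
    by_contra hcon
    have hlt := (lt_crit hd β).1.1 (not_le.1 hcon)
    obtain ⟨s, hs, ht⟩ := main_limit hβ hd hlt.ne'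
    have h1 := mx_zero_high hβ hd hlt hs
    have := tendsto_nhds_unique hT ht
    rw [h1] at this
    linarith
  · intro w hw
    obtain ⟨β, h1, h2⟩ := exists_between hw
    exact ⟨β, hin β h1, h2⟩
end

section
/- (Annealed pressure equals quenched pressure.) Let β > 0, B > 0 and let d ≥ 3 be an integer. Let h* > 0 be any solution of the fixed-point equation h = B + (d−1)·atanh( tanh(β)·tanh(h) ), and write u* = tanh(β)·tanh(h*). Then ψ(β,B) = (d/2)·log(cosh β) − (d/2)·log( (e^{2B}(1+u*)^d + (1−u*)^d) / (e^{2B}(1+u*)^{d−1} + (1−u*)^{d−1}) ) + log( e^{B}(1+u*)^d + e^{−B}(1−u*)^d ). -/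
open Filter MeasureTheory

namespace IsingAux

lemma quad (β s : ℝ) (h1 : s < 1) (h0 : 0 ≤ s) :
    (1 - s) * fIsing β s ^ 2 - Real.exp (-2*β) * (1 - 2*s) * fIsing β s - s = 0 := by
  unfold fIsing
  set c := Real.exp (-2*β)
  have hnn : 0 ≤ 1 + (c^2 - 1) * (1 - 2*s)^2 := by
    have : 1 + (c^2 - 1) * (1 - 2*s)^2 = c^2*(1-2*s)^2 + 4*s*(1-s) := by ring
    rw [this]
    have : 0 ≤ s*(1-s) := mul_nonneg h0 (by linarith)
    nlinarith [sq_nonneg (c*(1-2*s))]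
  have hsq := Real.sq_sqrt hnn
  set r := Real.sqrt (1 + (c^2 - 1) * (1 - 2*s)^2)
  have h3 : (1 - s) ≠ 0 := by linarith
  field_simp
  linear_combination hsq

lemma radpos (c s : ℝ) (hc : 0 < c) (h0 : 0 ≤ s) (h1 : s ≤ 1/2) :
    0 < 1 + (c^2 - 1) * (1 - 2*s)^2 := by
  have h : (1-2*s)^2 ≤ 1 := by nlinarith
  have : 0 ≤ (1-2*s)^2 := sq_nonneg _
  have hc2 : 0 < c^2 := by positivity
  by_cases hs : (1-2*s)^2 = 1
  · rw [hs]; linarith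
  · have : (1-2*s)^2 < 1 := lt_of_le_of_ne h hs
    nlinarith

lemma fpos (β s : ℝ) (h0 : 0 ≤ s) (h1 : s ≤ 1/2) : 0 < fIsing β s := by
  unfold fIsing
  have hc := Real.exp_pos (-2*β)
  have := Real.sqrt_pos.2 (radpos _ s hc h0 h1)
  apply div_pos _ (by linarith)
  have : 0 ≤ Real.exp (-2*β) * (1-2*s) := mul_nonneg hc.le (by linarith)
  linarith

lemma f_bounds (β s : ℝ) (hβ : 0 < β) (h0 : 0 < s) (h1 : s < 1/2) :
    Real.exp (-2*β) < fIsing β s ∧ fIsing β s < 1 := by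
  have q := quad β s (by linarith) h0.le
  have fp := fpos β s h0.le h1.le
  have hc := Real.exp_pos (-2*β)
  have hc1 : Real.exp (-2*β) < 1 := by rw [Real.exp_lt_one_iff]; linarith
  set c := Real.exp (-2*β)
  set f := fIsing β s
  constructor
  · by_contra h
    push Not at h
    have e1 : (1-s)*f - c*(1-2*s) ≤ c*s := by nlinarith
    have e2 : f*((1-s)*f - c*(1-2*s)) ≤ f*(c*s) := mul_le_mul_of_nonneg_left e1 fp.le
    have e3 : f * (c*s) ≤ c*(c*s) := mul_le_mul_of_nonneg_right h (by positivity)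
    have e4 : c*(c*s) < s := by
      have : c*c < 1 := by nlinarith
      nlinarith
    nlinarith
  · by_contra h
    push Not at h
    have e1 : (1-s) - c*(1-2*s) ≤ (1-s)*f - c*(1-2*s) := by nlinarith
    have e0 : s < (1-s) - c*(1-2*s) := by nlinarith
    have e2 : 1*((1-s)*f - c*(1-2*s)) ≤ f*((1-s)*f - c*(1-2*s)) :=
      mul_le_mul_of_nonneg_right h (by linarith)
    nlinarith

lemma quad_unique (a b s y z : ℝ) (hs : 0 < s) (hy : 0 < y) (hz : 0 < z) (ha : 0 < a)
    (h1 : a*y^2 - b*y - s = 0) (h2 : a*z^2 - b*z - s = 0) : y = z := by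
  have h : (y - z)*(a*y*z + s) = 0 := by linear_combination z*h1 - y*h2
  rcases mul_eq_zero.1 h with h | h
  · linarith
  · have : 0 < a*y*z+s := by positivity
    linarith

lemma Dpos (c y : ℝ) (hc : 0 < c) (hc1 : c < 1) : 0 < y^2 - 2*c*y + 1 := by
  nlinarith [sq_nonneg (y - c)]

noncomputable def Phi (β s : ℝ) : ℝ :=
  s * Real.log (fIsing β s)
    - 1/2 * Real.log (fIsing β s ^ 2 - 2*Real.exp (-2*β)*fIsing β s + 1)

lemma f_diff (β s : ℝ) (h0 : 0 ≤ s) (h1 : s ≤ 1/2) : DifferentiableAt ℝ (fIsing β) s := by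
  unfold fIsing
  have := radpos _ s (Real.exp_pos (-2*β)) h0 h1
  have h3 : 2*(1-s) ≠ 0 := by linarith
  fun_prop (disch := first | exact h3 | exact this.ne')

lemma Phi_deriv (β s : ℝ) (hβ : 0 < β) (h0 : 0 ≤ s) (h1 : s ≤ 1/2) :
    HasDerivAt (Phi β) (Real.log (fIsing β s)) s := by
  have fd := (f_diff β s h0 h1).hasDerivAt
  have q := quad β s (by linarith) h0
  have fp := fpos β s h0 h1
  have hc := Real.exp_pos (-2*β)
  have hc1 : Real.exp (-2*β) < 1 := by rw [Real.exp_lt_one_iff]; linarith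
  have D := Dpos _ (fIsing β s) hc hc1
  have k1 := (hasDerivAt_id s).mul (fd.log fp.ne')
  have k2 := ((((fd.pow 2).sub (fd.const_mul (2*Real.exp (-2*β)))).add_const 1).log
    (by simpa using D.ne')).const_mul (1/2)
  have k := k1.sub k2
  refine k.congr_deriv ?_
  simp
  set f := fIsing β s
  set f' := deriv (fIsing β) s
  set c := Real.exp (-2*β)
  have fn := fp.ne'
  have Dn := D.ne'
  have hcc : Real.exp (-(2*β)) = c := by simp [c]
  rw [hcc]
  have e : s * (f' / f) = s * (f^2-2*c*f+1) * f' / (f * (f^2-2*c*f+1)) := by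
    rw [mul_right_comm s, mul_div_mul_right _ _ Dn, mul_div_assoc]
  have e2 : s * (f^2-2*c*f+1) = f*(f-c) := by linear_combination -q
  rw [e, e2]
  generalize f^2-2*c*f+1 = Δ at *
  field_simp
  ring

lemma F_eq (β s : ℝ) (hβ : 0 < β) (h0 : 0 ≤ s) (h1 : s ≤ 1/2) :
    ∫ t in (0:ℝ)..s, Real.log (fIsing β t) = Phi β s - Phi β 0 := by
  apply intervalIntegral.integral_eq_sub_of_hasDerivAt
  · intro t ht
    rw [Set.uIcc_of_le h0] at ht
    exact Phi_deriv β t hβ ht.1 (ht.2.trans h1)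
  · apply ContinuousOn.intervalIntegrable
    intro t ht
    rw [Set.uIcc_of_le h0] at ht
    exact ((f_diff β t ht.1 (ht.2.trans h1)).continuousAt.log
      (fpos β t ht.1 (ht.2.trans h1)).ne').continuousWithinAt

lemma f_zero (β : ℝ) : fIsing β 0 = Real.exp (-2*β) := by
  unfold fIsing
  have : (1 + (Real.exp (-2*β)^2 - 1) * (1 - 2*(0:ℝ))^2) = Real.exp (-2*β)^2 := by ring
  rw [this, Real.sqrt_sq (Real.exp_pos _).le]
  ring

lemma Phi_zero (β : ℝ) : Phi β 0 = -(1/2 * Real.log (1 - Real.exp (-2*β)^2)) := by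
  unfold Phi
  rw [f_zero]
  ring_nf

/-- the concave function -/
noncomputable def aa (c p : ℝ) : ℝ := Real.log (Real.exp p + c) - Real.log (1 + c * Real.exp p)

lemma aa_deriv (c p : ℝ) (hc : 0 < c) :
    HasDerivAt (aa c) ((1-c^2)/(c*(2*Real.cosh p) + 1 + c^2)) p := by
  have e := Real.hasDerivAt_exp p
  have ep := Real.exp_pos p
  have k := ((e.add_const c).log (by positivity)).sub
    (((e.const_mul c).const_add 1).log (by positivity))
  refine k.congr_deriv ?_
  rw [Real.cosh_eq, Real.exp_neg]
  have : 0 < c * Real.exp p * Real.exp p := by positivity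
  field_simp
  ring

lemma aa_concave (c : ℝ) (hc : 0 < c) (hc1 : c < 1) : ConcaveOn ℝ (Set.Ici 0) (aa c) := by
  apply AntitoneOn.concaveOn_of_deriv (convex_Ici 0)
  · exact fun p _ => (aa_deriv c p hc).continuousAt.continuousWithinAt
  · exact fun p _ => (aa_deriv c p hc).differentiableAt.differentiableWithinAt
  · intro p hp q hq hpq
    rw [interior_Ici] at hp hq
    rw [(aa_deriv c p hc).deriv, (aa_deriv c q hc).deriv]
    have : Real.cosh p ≤ Real.cosh q := by
      rw [Real.cosh_le_cosh, abs_of_pos hp, abs_of_pos hq]; exact hpq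
    have := Real.cosh_pos p
    apply div_le_div_of_nonneg_left
    · nlinarith
    · positivity
    · nlinarith

lemma aa_zero (c : ℝ) : aa c 0 = 0 := by
  unfold aa
  simp [add_comm]

lemma scale (c : ℝ) (hc : 0 < c) (hc1 : c < 1) (p q : ℝ) (hp : 0 < p) (hpq : p < q) :
    p * aa c q ≤ q * aa c p := by
  have hq : 0 < q := hp.trans hpq
  have h := (aa_concave c hc hc1).2 (Set.mem_Ici.2 le_rfl) (Set.mem_Ici.2 hq.le)
    (show 0 ≤ 1 - p/q by rw [sub_nonneg, div_le_one hq]; exact hpq.le) (show 0 ≤ p/q by positivity) (by ring)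
  simp only [aa_zero, smul_eq_mul, mul_zero, zero_add] at h
  rw [div_mul_cancel₀ _ hq.ne', div_mul_eq_mul_div, div_le_iff₀ hq] at h
  linarith

lemma sign_lt (c m B p q : ℝ) (hc : 0 < c) (hc1 : c < 1) (hB : 0 < B) (hm : 0 ≤ m) (hp : 0 < p)
    (hpq : p < q) (hq : q = m * aa c q + 2*B) : p < m * aa c p + 2*B := by
  have h := scale c hc hc1 p q hp hpq
  have h1 : m*(p * aa c q) ≤ m*(q * aa c p) := mul_le_mul_of_nonneg_left h hm
  have h2 : p*q = p*(m*aa c q + 2*B) := by rw [← hq]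
  have h3 : q * p < q*(m * aa c p + 2*B) := by nlinarith
  exact lt_of_mul_lt_mul_left h3 (by linarith)

lemma sign_gt (c m B p q : ℝ) (hc : 0 < c) (hc1 : c < 1) (hB : 0 < B) (hm : 0 ≤ m) (hp : 0 < p)
    (hpq : p < q) (hq : p = m * aa c p + 2*B) : m * aa c q + 2*B < q := by
  have h := scale c hc hc1 p q hp hpq
  have h1 : m*(p * aa c q) ≤ m*(q * aa c p) := mul_le_mul_of_nonneg_left h hm
  have h2 : q*p = q*(m*aa c p + 2*B) := by rw [← hq]
  have h3 : p*(m * aa c q + 2*B) < p*q := by nlinarith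
  exact lt_of_mul_lt_mul_left h3 hp.le

/-- `p` as a function of `s`. -/
lemma p_facts (β s : ℝ) (hβ : 0 < β) (h0 : 0 < s) (h1 : s < 1/2) :
    0 < Real.log ((1-s)/s) + Real.log (fIsing β s) ∧
    Real.log (fIsing β s) =
      - aa (Real.exp (-2*β)) (Real.log ((1-s)/s) + Real.log (fIsing β s)) := by
  obtain ⟨b1, b2⟩ := f_bounds β s hβ h0 h1
  have q := quad β s (by linarith) h0.le
  have fp := fpos β s h0.le h1.le
  have hc := Real.exp_pos (-2*β)
  have hc1 : Real.exp (-2*β) < 1 := by rw [Real.exp_lt_one_iff]; linarith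
  set c := Real.exp (-2*β)
  set f := fIsing β s
  have hs : 0 < (1-s)/s := div_pos (by linarith) h0
  have hcf : 0 < 1 - c*f := by nlinarith
  have hfc : 0 < f - c := by linarith
  have key : (1-s)/s * f = (1-c*f)/(f-c) := by
    rw [div_mul_eq_mul_div, div_eq_div_iff h0.ne' hfc.ne']
    linear_combination q
  rw [← Real.log_mul hs.ne' fp.ne', key]
  constructor
  · apply Real.log_pos
    rw [one_lt_div hfc]
    nlinarith
  · unfold aa
    rw [Real.exp_log (div_pos hcf hfc), neg_sub]
    have e1 : 1 + c*((1-c*f)/(f-c)) = f*(1-c^2)/(f-c) := by field_simp; ring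
    have e2 : (1-c*f)/(f-c) + c = (1-c^2)/(f-c) := by field_simp; ring
    have hc2 : 0 < 1-c^2 := by nlinarith
    rw [e1, e2, Real.log_div (by positivity) hfc.ne', Real.log_div hc2.ne' hfc.ne',
      Real.log_mul fp.ne' hc2.ne']
    ring

lemma f_mono (β s t : ℝ) (hβ : 0 < β) (h0 : 0 < s) (hst : s < t) (h1 : t < 1/2) :
    fIsing β s < fIsing β t := by
  obtain ⟨b1, b2⟩ := f_bounds β s hβ h0 (hst.trans h1)
  obtain ⟨b3, b4⟩ := f_bounds β t hβ (h0.trans hst) h1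
  have q := quad β s (by linarith) h0.le
  have q' := quad β t (by linarith) (by linarith)
  have hc := Real.exp_pos (-2*β)
  have hc1 : Real.exp (-2*β) < 1 := by rw [Real.exp_lt_one_iff]; linarith
  set c := Real.exp (-2*β)
  set f := fIsing β s
  set g := fIsing β t
  by_contra h
  push Not at h
  have D1 := Dpos c f hc hc1
  have D2 := Dpos c g hc hc1
  have e1 : s * (f^2-2*c*f+1) = f*(f-c) := by linear_combination -q
  have e2 : (1-t) * (g^2-2*c*g+1) = 1-c*g := by linear_combination q'
  have e3 : (1-s) * (f^2-2*c*f+1) = 1-c*f := by linear_combination q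
  have e4 : t * (g^2-2*c*g+1) = g*(g-c) := by linear_combination -q'
  have k1 : g*(g-c) ≤ f*(f-c) := by nlinarith
  have k2 : 1-c*f ≤ 1 - c*g := by nlinarith
  have k3 : (g*(g-c))*(1-c*f) ≤ (f*(f-c))*(1-c*g) := by
    apply mul_le_mul k1 k2
    · nlinarith
    · apply mul_nonneg <;> linarith
  rw [← e1, ← e2, ← e3, ← e4] at k3
  have k4 : 0 < (f^2-2*c*f+1)*(g^2-2*c*g+1) := mul_pos D1 D2
  nlinarith

lemma p_anti (β s t : ℝ) (hβ : 0 < β) (h0 : 0 < s) (hst : s < t) (h1 : t < 1/2) :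
    Real.log ((1-t)/t) + Real.log (fIsing β t) < Real.log ((1-s)/s) + Real.log (fIsing β s) := by
  have p1 := (p_facts β s hβ h0 (hst.trans h1)).2
  have p2 := (p_facts β t hβ (h0.trans hst) h1).2
  have m := Real.log_lt_log (fpos β s h0.le (by linarith)) (f_mono β s t hβ h0 hst h1)
  by_contra h
  push Not at h
  have hc := Real.exp_pos (-2*β)
  have hc1 : Real.exp (-2*β) < 1 := by rw [Real.exp_lt_one_iff]; linarith
  have mono : StrictMono (aa (Real.exp (-2*β))) := by
    apply strictMono_of_deriv_pos
    intro x
    rw [(aa_deriv _ x hc).deriv]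
    have := Real.cosh_pos x
    apply div_pos
    · nlinarith
    · positivity
  have := mono.monotone h
  linarith

noncomputable def M (β B : ℝ) (d : ℕ) (s : ℝ) : ℝ :=
  Real.binEntropy s + d * Phi β s + 2*B*(1-s)

lemma I_eq (s : ℝ) : IIsing s = Real.binEntropy s := by
  unfold IIsing
  rw [Real.binEntropy, Real.log_inv, Real.log_inv]
  ring

lemma M_deriv (β B : ℝ) (d : ℕ) (s : ℝ) (hβ : 0 < β) (h0 : 0 < s) (h1 : s < 1/2) :
    HasDerivAt (M β B d) (Real.log ((1-s)/s) + d * Real.log (fIsing β s) - 2*B) s := by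
  have k := ((Real.hasDerivAt_binEntropy h0.ne' (by linarith)).add
    ((Phi_deriv β s hβ h0.le h1.le).const_mul (d:ℝ))).add
    (((hasDerivAt_id s).const_sub 1).const_mul (2*B))
  refine k.congr_deriv ?_
  rw [Real.log_div (by linarith) h0.ne']
  ring

lemma M_cont (β B : ℝ) (d : ℕ) (hβ : 0 < β) : ContinuousOn (M β B d) (Set.Icc 0 (1/2)) := by
  intro s hs
  have := (Phi_deriv β s hβ hs.1 hs.2).continuousAt
  have h2 := Real.binEntropy_continuous.continuousAt (x := s)
  unfold M
  apply ContinuousAt.continuousWithinAt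
  fun_prop

lemma M_max (β B : ℝ) (d : ℕ) (t : ℝ) (hβ : 0 < β) (hB : 0 < B) (hd : 3 ≤ d)
    (h0 : 0 < t) (h1 : t < 1/2)
    (hcrit : Real.log ((1-t)/t) + d * Real.log (fIsing β t) - 2*B = 0) (s : ℝ)
    (hs0 : 0 ≤ s) (hs1 : s ≤ 1/2) : M β B d s ≤ M β B d t := by
  have hc := Real.exp_pos (-2*β)
  have hc1 : Real.exp (-2*β) < 1 := by rw [Real.exp_lt_one_iff]; linarith
  have hm : (0:ℝ) ≤ (d:ℝ) - 1 := by
    have : (3:ℝ) ≤ d := by exact_mod_cast hd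
    linarith
  obtain ⟨pt, at'⟩ := p_facts β t hβ h0 h1
  have hfix : Real.log ((1-t)/t) + Real.log (fIsing β t) = ((d:ℝ)-1) *
      aa (Real.exp (-2*β)) (Real.log ((1-t)/t) + Real.log (fIsing β t)) + 2*B := by
    linear_combination hcrit - ((d:ℝ)-1) * at'
  rcases le_total s t with h | h
  · have mono : MonotoneOn (M β B d) (Set.Icc 0 t) := by
      apply monotoneOn_of_deriv_nonneg (convex_Icc 0 t)
      · exact (M_cont β B d hβ).mono (Set.Icc_subset_Icc le_rfl h1.le)
      · intro x hx
        rw [interior_Icc] at hx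
        exact (M_deriv β B d x hβ hx.1 (hx.2.trans h1)).differentiableAt.differentiableWithinAt
      · intro x hx
        rw [interior_Icc] at hx
        rw [(M_deriv β B d x hβ hx.1 (hx.2.trans h1)).deriv]
        obtain ⟨px, ax⟩ := p_facts β x hβ hx.1 (hx.2.trans h1)
        have := sign_gt _ _ B _ _ hc hc1 hB hm pt (p_anti β x t hβ hx.1 hx.2 h1) hfix
        linear_combination this - ((d:ℝ)-1)*ax
    exact mono ⟨hs0, h⟩ ⟨h0.le, le_rfl⟩ h
  · have anti : AntitoneOn (M β B d) (Set.Icc t (1/2)) := by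
      apply antitoneOn_of_deriv_nonpos (convex_Icc t (1/2))
      · exact (M_cont β B d hβ).mono (Set.Icc_subset_Icc h0.le le_rfl)
      · intro x hx
        rw [interior_Icc] at hx
        exact (M_deriv β B d x hβ (h0.trans hx.1) hx.2).differentiableAt.differentiableWithinAt
      · intro x hx
        rw [interior_Icc] at hx
        rw [(M_deriv β B d x hβ (h0.trans hx.1) hx.2).deriv]
        obtain ⟨px, ax⟩ := p_facts β x hβ (h0.trans hx.1) hx.2
        have := sign_lt _ _ B _ _ hc hc1 hB hm px (p_anti β t x hβ h0 hx.1 hx.2) hfix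
        linear_combination this + ((d:ℝ)-1)*ax
    exact anti ⟨le_rfl, h1.le⟩ ⟨h, hs1⟩ h

lemma L_eq (β B : ℝ) (d : ℕ) (hβ : 0 < β) (s : ℝ) (hs0 : 0 ≤ s) (hs1 : s ≤ 1/2) :
    LIsing β B d (1-s) = M β B d s - d * Phi β 0 ∧
    LIsing β B d s = M β B d s - d * Phi β 0 - 2*B*(1-2*s) := by
  unfold LIsing HIsing FIsing M
  have e1 : min (1-s) (1-(1-s)) = s := by rw [min_eq_right] <;> linarith
  have e2 : min s (1-s) = s := by rw [min_eq_left]; linarith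
  rw [e1, e2, F_eq β s hβ hs0 hs1, I_eq, I_eq, Real.binEntropy_one_sub]
  constructor <;> ring

lemma sup_eq (β B : ℝ) (d : ℕ) (t : ℝ) (hβ : 0 < β) (hB : 0 < B) (hd : 3 ≤ d)
    (h0 : 0 < t) (h1 : t < 1/2)
    (hcrit : Real.log ((1-t)/t) + d * Real.log (fIsing β t) - 2*B = 0) :
    sSup ((LIsing β B d) '' Set.Icc (0:ℝ) 1) = M β B d t - d * Phi β 0 := by
  apply IsGreatest.csSup_eq
  constructor
  · exact ⟨1-t, ⟨by linarith, by linarith⟩, (L_eq β B d hβ t h0.le h1.le).1⟩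
  · rintro _ ⟨s, ⟨hs0, hs1⟩, rfl⟩
    rcases le_total s (1/2) with h | h
    · rw [(L_eq β B d hβ s hs0 h).2]
      have := M_max β B d t hβ hB hd h0 h1 hcrit s hs0 h
      have : 0 ≤ 2*B*(1-2*s) := mul_nonneg (by linarith) (by linarith)
      linarith
    · have := (L_eq β B d hβ (1-s) (by linarith) (by linarith)).1
      rw [sub_sub_cancel] at this
      rw [this]
      have := M_max β B d t hβ hB hd h0 h1 hcrit (1-s) (by linarith) (by linarith)
      linarith

lemma tanh_eq (h : ℝ) : Real.tanh h = (1 - Real.exp (-2*h)) / (1 + Real.exp (-2*h)) := by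
  have : Real.exp (-2*h) = Real.exp (-h) * Real.exp (-h) := by rw [← Real.exp_add]; ring_nf
  rw [Real.tanh_eq, this, Real.exp_neg]
  have := Real.exp_pos h
  field_simp

lemma cosh_eq' (β : ℝ) : Real.cosh β = Real.exp β * (1 + Real.exp (-2*β)) / 2 := by
  rw [Real.cosh_eq, mul_add, ← Real.exp_add]
  ring_nf

end IsingAux

open IsingAux

/-- Annealed pressure equals quenched pressure: for `β, B > 0` and
`d ≥ 3`, writing `u* = tanh(β)tanh(h*)` with `h*` a positive solution of the quenched
fixed-point equation, the annealed pressure has the quenched expression. -/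
theorem annealed_eq_quenched_pressure (β B : ℝ) (hβ : 0 < β) (hB : 0 < B)
    (d : ℕ) (hd : 3 ≤ d)
    (hstar : ℝ) (hh : 0 < hstar)
    (hfix : hstar = B + ((d:ℝ)-1) * artanh (Real.tanh β * Real.tanh hstar)) :
    psiIsing β B d =
      (d:ℝ)/2 * Real.log (Real.cosh β)
      - (d:ℝ)/2 * Real.log
          ((Real.exp (2*B) * (1 + Real.tanh β * Real.tanh hstar)^d
              + (1 - Real.tanh β * Real.tanh hstar)^d) /
            (Real.exp (2*B) * (1 + Real.tanh β * Real.tanh hstar)^(d-1)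
              + (1 - Real.tanh β * Real.tanh hstar)^(d-1)))
      + Real.log (Real.exp B * (1 + Real.tanh β * Real.tanh hstar)^d
          + Real.exp (-B) * (1 - Real.tanh β * Real.tanh hstar)^d) := by
  have hτ := tanh_eq β
  have hη := tanh_eq hstar
  have hc := Real.exp_pos (-2*β)
  have hc1 : Real.exp (-2*β) < 1 := by rw [Real.exp_lt_one_iff]; linarith
  have hq := Real.exp_pos (-2*hstar)
  have hq1 : Real.exp (-2*hstar) < 1 := by rw [Real.exp_lt_one_iff]; linarith
  have hlq : Real.log (Real.exp (-2*hstar)) = -2*hstar := Real.log_exp _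
  have hPhi0 := Phi_zero β
  have hquad := quad β
  have hsup := fun t => sup_eq β B d t hβ hB hd
  have hPhi : ∀ s, Phi β s = s * Real.log (fIsing β s)
    - 1/2 * Real.log (fIsing β s ^ 2 - 2*Real.exp (-2*β)*fIsing β s + 1) := fun s => rfl
  have hcosh : Real.log (Real.cosh β) = β + Real.log (1 + Real.exp (-2*β)) - Real.log 2 := by
    rw [cosh_eq', Real.log_div (by positivity) (by norm_num), Real.log_mul (by positivity)
      (by positivity), Real.log_exp]
  set c := Real.exp (-2*β)
  set q := Real.exp (-2*hstar)
  set u := Real.tanh β * Real.tanh hstar with hu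
  have hu0 : 0 < u := by
    rw [hu, hτ, hη]
    exact mul_pos (div_pos (by linarith) (by linarith)) (div_pos (by linarith) (by linarith))
  have hu1 : u < 1 := by
    rw [hu, hτ, hη, div_mul_div_comm, div_lt_one (by positivity)]
    nlinarith
  obtain ⟨x, hx⟩ : ∃ x, x = (1-u)/(1+u) := ⟨_, rfl⟩
  have hx0 : 0 < x := by rw [hx]; exact div_pos (by linarith) (by linarith)
  have hxq : x = (c + q)/(1 + c*q) := by
    have h1 : 0 < 1 + c := by linarith
    have h2 : 0 < 1 + q := by linarith
    have e1 : 1 - u = 2*(c+q)/((1+c)*(1+q)) := by rw [hu, hτ, hη]; field_simp; ring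
    have e2 : 1 + u = 2*(1+c*q)/((1+c)*(1+q)) := by rw [hu, hτ, hη]; field_simp; ring
    rw [hx, e1, e2]
    field_simp
  have hcq : 0 < 1 + c*q := by positivity
  have hcx : 1 - c*x = (1-c^2)/(1+c*q) := by rw [hxq]; field_simp; ring
  have hxc : x - c = q*(1-c^2)/(1+c*q) := by rw [hxq]; field_simp; ring
  have hc2 : 0 < 1 - c^2 := by nlinarith
  have hcx0 : 0 < 1 - c*x := by rw [hcx]; positivity
  have hxc0 : 0 < x - c := by rw [hxc]; positivity
  have hx1 : x < 1 := by rw [hx, div_lt_one (by linarith)]; linarith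
  have D := Dpos c x hc hc1
  obtain ⟨Δ, hΔ⟩ : ∃ Δ, Δ = x^2-2*c*x+1 := ⟨_, rfl⟩
  obtain ⟨e, he⟩ : ∃ e, e = 1-c*x := ⟨_, rfl⟩
  rw [← hΔ] at D
  rw [← he] at hcx hcx0
  set s := x*(x-c)/Δ with hs
  have hs' : 1 - s = (e)/(Δ) := by rw [hs]; field_simp; rw [hΔ, he]; ring
  have hs0 : 0 < s := by positivity
  have hs1p : 0 < 1 - s := by rw [hs']; positivity
  have hs1 : s < 1/2 := by
    rw [hs, div_lt_iff₀ D, hΔ]; nlinarith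
  have hfs : fIsing β s = x := by
    apply quad_unique (1-s) (c*(1-2*s)) s _ _ hs0 (fpos β s hs0.le hs1.le) hx0 hs1p
      (hquad s (by linarith) hs0.le)
    have e1 : s * Δ = x*(x-c) := by rw [hs]; field_simp
    rw [hΔ] at e1
    linear_combination -e1
  have hlx : artanh u = -(1/2) * Real.log x := by
    unfold artanh
    rw [hx, ← inv_div (1+u) (1-u), Real.log_inv]; ring
  rw [hlx] at hfix
  have hratio : (1-s)/s = 1/(x*q) := by
    have : x - c = q*(e) := by rw [hxc, hcx]; ring
    rw [hs', hs, this]; field_simp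
  have hlr : Real.log ((1-s)/s) = - Real.log x + 2*hstar := by
    rw [hratio, one_div, Real.log_inv, Real.log_mul hx0.ne' hq.ne', hlq]; ring
  have hcrit : Real.log ((1-s)/s) + d * Real.log (fIsing β s) - 2*B = 0 := by
    rw [hlr, hfs]; linear_combination (2:ℝ)*hfix
  unfold psiIsing
  rw [hsup s hs0 hs1 hcrit, hPhi0, M, hPhi, hcosh, ← I_eq, IIsing]
  rw [hfs] at hcrit ⊢
  rw [← hΔ]
  have hls : Real.log s = Real.log (1-s) - (2*B - d*Real.log x) := by
    rw [Real.log_div hs1p.ne' hs0.ne'] at hcrit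
    linarith
  have hu1' : 1 - u = x*(1+u) := by rw [hx]; field_simp
  have h1u : 0 < 1 + u := by linarith
  have hxd : x^d = Real.exp (2*B) * (s/(1-s)) := by
    apply Real.log_injOn_pos
    · exact Set.mem_Ioi.2 (by positivity)
    · exact Set.mem_Ioi.2 (by positivity)
    rw [Real.log_pow, Real.log_mul (by positivity) (by positivity), Real.log_exp,
      Real.log_div hs0.ne' hs1p.ne', hls]; ring
  obtain ⟨m, rfl⟩ : ∃ m, d = m + 1 := ⟨d-1, by omega⟩
  have hxm : x^m = Real.exp (2*B) * ((x-c)/(e)) := by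
    have : x^m = x^(m+1)/x := by rw [pow_succ]; field_simp
    rw [this, hxd, hs', hs]; field_simp
  have hA : Real.exp (2*B) * (1+u)^(m+1) + (1-u)^(m+1) =
      (1+u)^(m+1) * Real.exp (2*B) / (1-s) := by
    rw [hu1', mul_pow, hxd]; field_simp; ring
  have hC : Real.exp (2*B) * (1+u)^m + (1-u)^m =
      (1+u)^m * Real.exp (2*B) * ((1+x)*(1-c)) / (e) := by
    rw [hu1', mul_pow, hxm]; field_simp; rw [he]; ring
  have hE : Real.exp B * (1+u)^(m+1) + Real.exp (-B) * (1-u)^(m+1) =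
      Real.exp (-B) * ((1+u)^(m+1) * Real.exp (2*B) / (1-s)) := by
    rw [← hA, mul_add, ← mul_assoc, ← Real.exp_add]; ring_nf
  have h1x : 1 + x = 2/(1+u) := by rw [hx]; field_simp; ring
  have h1c : 0 < 1 - c := by linarith
  have hR : (Real.exp (2*B) * (1+u)^(m+1) + (1-u)^(m+1)) /
      (Real.exp (2*B) * (1+u)^m + (1-u)^m) = (1+u)^2 * (Δ) / (2*(1-c)) := by
    rw [hA, hC, h1x, hs']; field_simp; ring
  rw [Nat.add_sub_cancel, hR, hE]
  have l1 : Real.log ((1+u)^2 * (Δ) / (2*(1-c))) =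
      2*Real.log (1+u) + Real.log (Δ) - Real.log 2 - Real.log (1-c) := by
    rw [Real.log_div (by positivity) (by positivity), Real.log_mul (by positivity) D.ne',
      Real.log_mul (by norm_num) h1c.ne', Real.log_pow]
    push_cast; ring
  have l2 : Real.log (Real.exp (-B) * ((1+u)^(m+1) * Real.exp (2*B) / (1-s))) =
      B + ((m+1:ℕ):ℝ)*Real.log (1+u) - Real.log (1-s) := by
    rw [Real.log_mul (by positivity) (by positivity), Real.log_div (by positivity) hs1p.ne',
      Real.log_mul (by positivity) (by positivity), Real.log_exp, Real.log_exp, Real.log_pow]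
    ring
  have l3 : Real.log (1-c^2) = Real.log (1-c) + Real.log (1+c) := by
    rw [← Real.log_mul h1c.ne' (by positivity)]; ring_nf
  rw [l1, l2, l3, hls]
  ring
end

section
/- For every β ≥ 0 there exists a constant C = C(β) > 0 such that for all sufficiently large m and all integers 0 ≤ k ≤ ℓ ≤ m, | [ log g(β,k,m) − m·F(β,k/m) ] − [ log g(β,ℓ,m) − m·F(β,ℓ/m) ] | ≤ C·|k−ℓ|/m. -/
open Filter MeasureTheory

/-- the discriminant root -/
noncomputable def SS (c t : ℝ) : ℝ := Real.sqrt (1 + (c^2 - 1) * (1 - 2*t)^2)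

/-- `fIsing` with `c` as parameter -/
noncomputable def ff (c t : ℝ) : ℝ := (c * (1 - 2*t) + SS c t) / (2*(1-t))

theorem arg_ge {c t : ℝ} (hc0 : 0 < c) (hc1 : c ≤ 1) (ht0 : 0 ≤ t) (ht1 : t ≤ 1/2) :
    c^2 ≤ 1 + (c^2 - 1) * (1 - 2*t)^2 := by
  have h1 : (1 - 2*t)^2 ≤ 1 := by nlinarith
  have h2 : c^2 ≤ 1 := by nlinarith
  nlinarith

theorem SS_sq {c t : ℝ} (hc0 : 0 < c) (hc1 : c ≤ 1) (ht0 : 0 ≤ t) (ht1 : t ≤ 1/2) :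
    SS c t ^ 2 = 1 + (c^2 - 1) * (1 - 2*t)^2 := by
  unfold SS
  apply Real.sq_sqrt
  have := arg_ge hc0 hc1 ht0 ht1
  nlinarith [sq_nonneg c]

theorem SS_ge {c t : ℝ} (hc0 : 0 < c) (hc1 : c ≤ 1) (ht0 : 0 ≤ t) (ht1 : t ≤ 1/2) :
    c ≤ SS c t := Real.le_sqrt_of_sq_le (arg_ge hc0 hc1 ht0 ht1)

theorem SS_le {c t : ℝ} (hc0 : 0 < c) (hc1 : c ≤ 1) : SS c t ≤ 1 := by
  unfold SS
  refine Real.sqrt_le_iff.2 ⟨by norm_num, ?_⟩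
  have h2 : c^2 ≤ 1 := by nlinarith
  nlinarith [sq_nonneg (1 - 2*t)]

theorem ff_ge {c t : ℝ} (hc0 : 0 < c) (hc1 : c ≤ 1) (ht0 : 0 ≤ t) (ht1 : t ≤ 1/2) :
    c ≤ ff c t := by
  unfold ff
  rw [le_div_iff₀ (by linarith)]
  nlinarith [SS_ge hc0 hc1 ht0 ht1]

theorem ff_le {c t : ℝ} (hc0 : 0 < c) (hc1 : c ≤ 1) (ht1 : t ≤ 1/2) :
    ff c t ≤ 1 := by
  unfold ff
  rw [div_le_one (by linarith)]
  nlinarith [SS_le hc0 hc1 (t := t)]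

theorem ff_quad {c t : ℝ} (hc0 : 0 < c) (hc1 : c ≤ 1) (ht0 : 0 ≤ t) (ht1 : t ≤ 1/2) :
    (1 - t) * ff c t ^ 2 = c * (1 - 2*t) * ff c t + t := by
  have h := SS_sq hc0 hc1 ht0 ht1
  have h1 : (1 - t) ≠ 0 := by linarith
  unfold ff
  field_simp
  linear_combination h

/-- derivative of `log ff` -/
noncomputable def vv (c t : ℝ) : ℝ := 2 * (1 - c^2) / (SS c t * (SS c t + c))

theorem hasDerivAt_log_ff {c t : ℝ} (hc0 : 0 < c) (hc1 : c ≤ 1) (ht0 : 0 ≤ t) (ht1 : t ≤ 1/2) :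
    HasDerivAt (fun s => Real.log (ff c s)) (vv c t) t := by
  have hS := SS_sq hc0 hc1 ht0 ht1
  have hSg := SS_ge hc0 hc1 ht0 ht1
  have harg := arg_ge hc0 hc1 ht0 ht1
  have hf := ff_ge hc0 hc1 ht0 ht1
  have hlin : HasDerivAt (fun s : ℝ => 1 - 2*s) (-2) t := by
    simpa using ((hasDerivAt_id t).const_mul 2).const_sub 1
  have hq : HasDerivAt (fun s : ℝ => 1 + (c^2 - 1) * (1 - 2*s)^2)
      ((c^2-1) * (2 * (1 - 2*t) * (-2))) t := by
    simpa using ((hlin.pow 2).const_mul (c^2-1)).const_add 1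
  have hSd : HasDerivAt (fun s => SS c s)
      ((c^2-1) * (2 * (1 - 2*t) * (-2)) / (2 * SS c t)) t :=
    hq.sqrt (by nlinarith [pow_pos hc0 2])
  have hden : HasDerivAt (fun s : ℝ => 2*(1-s)) (-2) t := by
    simpa using ((hasDerivAt_id t).const_sub 1).const_mul 2
  have hfd := ((hlin.const_mul c).add hSd).div hden (by linarith)
  have hl := HasDerivAt.log hfd (by
    have : 0 < ff c t := by linarith
    exact this.ne')
  refine hl.congr_deriv ?_
  simp only [Pi.add_apply, Pi.div_apply, vv]
  have h1 : (1 - t) ≠ 0 := by linarith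
  have h2 : SS c t ≠ 0 := by linarith
  have h3 : SS c t + c ≠ 0 := by linarith
  have h4 : c * (1 - 2*t) + SS c t ≠ 0 := by nlinarith
  have key : ((c^2-1) * (2 * (1 - 2*t) * (-2)) / (2 * SS c t) + c * (-2))
      = 2 * ((1 - c^2) * (1-2*t) - c * SS c t) / SS c t := by
    field_simp; ring
  rw [add_comm (c * -2), key]
  generalize SS c t = S at *
  rw [div_div_eq_mul_div, div_mul_eq_mul_div, div_div, div_eq_div_iff (by positivity) (by positivity)]
  field_simp
  linear_combination S * hS

theorem vv_le {c t : ℝ} (hc0 : 0 < c) (hc1 : c ≤ 1) (ht0 : 0 ≤ t) (ht1 : t ≤ 1/2) :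
    vv c t ≤ 1 / c^2 := by
  have hSg := SS_ge hc0 hc1 ht0 ht1
  unfold vv
  rw [div_le_div_iff₀ (by nlinarith) (by positivity)]
  nlinarith [mul_le_mul hSg hSg hc0.le (by linarith), mul_le_mul_of_nonneg_right hSg hc0.le,
    sq_nonneg (c^2)]

theorem vv_ge {c t : ℝ} (hc0 : 0 < c) (hc1 : c ≤ 1) (ht0 : 0 ≤ t) (ht1 : t ≤ 1/2) :
    1 - c^2 ≤ vv c t := by
  have hSg := SS_ge hc0 hc1 ht0 ht1
  have hSl := SS_le hc0 hc1 (t := t)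
  have h2 : c^2 ≤ 1 := by nlinarith
  unfold vv
  rw [le_div_iff₀ (by nlinarith)]
  have : SS c t * (SS c t + c) ≤ 2 := by nlinarith
  nlinarith

theorem vv_diff {c t x : ℝ} (hc0 : 0 < c) (hc1 : c ≤ 1) (hx : 0 ≤ x) (htx : x ≤ t)
    (ht1 : t + x ≤ 1/2) :
    vv c (t - x) - vv c (t + x) ≤ 6 * (1 - c^2) * (1 - 2*t) * x / c^4 := by
  have h1 := SS_sq hc0 hc1 (t := t - x) (by linarith) (by linarith)
  have h2 := SS_sq hc0 hc1 (t := t + x) (by linarith) (by linarith)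
  have g1 := SS_ge hc0 hc1 (t := t - x) (by linarith) (by linarith)
  have g2 := SS_ge hc0 hc1 (t := t + x) (by linarith) (by linarith)
  unfold vv
  generalize SS c (t - x) = S at *
  generalize SS c (t + x) = T at *
  have ha : 0 ≤ 1 - c^2 := by nlinarith
  have ha1 : 1 - c^2 ≤ 1 := by nlinarith
  have hS : 0 < S := by linarith
  have hT : 0 < T := by linarith
  set a := 1 - c^2 with hadef
  have hux : 0 ≤ (1-2*t)*x := mul_nonneg (by linarith) hx
  have hd : (T - S) * (T + S) = 8 * a * ((1-2*t) * x) := by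
    rw [hadef]; linear_combination h2 - h1
  have hTS : 0 ≤ T - S := by
    by_contra hneg
    push Not at hneg
    have : (T-S)*(T+S) < 0 := mul_neg_of_neg_of_pos hneg (by linarith)
    have : 0 ≤ 8 * a * ((1-2*t) * x) := by positivity
    linarith
  have hnum : T*(T+c) - S*(S+c) ≤ 12 * ((1-2*t)*x) := by
    have e : T*(T+c) - S*(S+c) = (T-S)*(T+S) + (T-S)*c := by ring
    have : (T-S)*c*2 ≤ (T-S)*(T+S) := by nlinarith
    nlinarith
  have hden : 4 * c^4 ≤ (S*(S+c))*(T*(T+c)) := by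
    have e1 : 2*c^2 ≤ S*(S+c) := by nlinarith
    have e2 : 2*c^2 ≤ T*(T+c) := by nlinarith
    have := mul_le_mul e1 e2 (by positivity) (by positivity)
    nlinarith
  have e : 2*a/(S*(S+c)) - 2*a/(T*(T+c)) = 2*a*(T*(T+c) - S*(S+c)) / ((S*(S+c))*(T*(T+c))) := by
    field_simp
  rw [e]
  calc _ ≤ 2*a*(12 * ((1-2*t)*x)) / (4*c^4) := by
        apply div_le_div₀ (by positivity) _ (by positivity) hden
        exact mul_le_mul_of_nonneg_left hnum (by positivity)
    _ = _ := by field_simp; ring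

/-- `log ff` is close to linear in the symmetric second difference. -/
theorem second_diff {c t h : ℝ} (hc0 : 0 < c) (hc1 : c ≤ 1) (hh : 0 ≤ h) (hth : h ≤ t)
    (ht1 : t + h ≤ 1/2) :
    2 * Real.log (ff c t) - 3 * (1 - c^2) * (1 - 2*t) / c^4 * h^2
      ≤ Real.log (ff c (t+h)) + Real.log (ff c (t-h)) := by
  set K := 3 * (1 - c^2) * (1 - 2*t) / c^4 with hK
  let φ : ℝ → ℝ := fun x => Real.log (ff c (t+x)) + Real.log (ff c (t-x)) + K * x^2
  have hd : ∀ x ∈ Set.Icc 0 h, HasDerivAt φ (vv c (t+x) - vv c (t-x) + K * (2*x)) x := by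
    intro x hx
    have d1 : HasDerivAt (fun x => Real.log (ff c (t+x))) (vv c (t+x) * 1) x :=
      HasDerivAt.comp x (hasDerivAt_log_ff hc0 hc1 (t := t+x) (by linarith [hx.1, hx.2])
        (by linarith [hx.1, hx.2])) ((hasDerivAt_id x).const_add t)
    have d2 : HasDerivAt (fun x => Real.log (ff c (t-x))) (vv c (t-x) * (-1)) x :=
      HasDerivAt.comp x (hasDerivAt_log_ff hc0 hc1 (t := t-x) (by linarith [hx.1, hx.2])
        (by linarith [hx.1, hx.2])) ((hasDerivAt_id x).const_sub t)
    have d3 : HasDerivAt (fun x : ℝ => K * x^2) (K * (2*x)) x := by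
      simpa using (hasDerivAt_pow 2 x).const_mul K
    exact ((d1.add d2).add d3).congr_deriv (by ring)
  have hm : MonotoneOn φ (Set.Icc 0 h) := by
    apply monotoneOn_of_hasDerivWithinAt_nonneg (convex_Icc 0 h)
      (f' := fun x => vv c (t+x) - vv c (t-x) + K * (2*x))
    · exact fun x hx => (hd x hx).continuousAt.continuousWithinAt
    · exact fun x hx => (hd x (interior_subset hx)).hasDerivWithinAt
    · intro x hx
      have hx' := interior_subset hx
      have := vv_diff hc0 hc1 hx'.1 (by linarith [hx'.2]) (t := t) (by linarith [hx'.2])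
      have e : K * (2*x) = 6 * (1 - c^2) * (1 - 2*t) * x / c^4 := by rw [hK]; ring
      rw [e]; linarith
  have := hm (Set.left_mem_Icc.2 hh) (Set.right_mem_Icc.2 hh) hh
  simp only [φ] at this
  simp at this
  linarith

theorem log_ff_diff {c s t : ℝ} (hc0 : 0 < c) (hc1 : c ≤ 1) (hs : 0 ≤ s) (hst : s ≤ t)
    (ht1 : t ≤ 1/2) :
    (1 - c^2) * (t - s) ≤ Real.log (ff c t) - Real.log (ff c s) ∧
    Real.log (ff c t) - Real.log (ff c s) ≤ 1/c^2 * (t - s) := by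
  have hd : ∀ x ∈ Set.Icc s t, HasDerivAt (fun s => Real.log (ff c s)) (vv c x) x :=
    fun x hx => hasDerivAt_log_ff hc0 hc1 (by linarith [hx.1]) (by linarith [hx.2])
  have hcont : ContinuousOn (fun s => Real.log (ff c s)) (Set.Icc s t) :=
    fun x hx => (hd x hx).continuousAt.continuousWithinAt
  have hdiff : DifferentiableOn ℝ (fun s => Real.log (ff c s)) (interior (Set.Icc s t)) :=
    fun x hx => (hd x (interior_subset hx)).differentiableAt.differentiableWithinAt
  constructor
  · refine (convex_Icc s t).mul_sub_le_image_sub_of_le_deriv hcont hdiff ?_ s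
      (Set.left_mem_Icc.2 hst) t (Set.right_mem_Icc.2 hst) hst
    intro x hx
    have hx' := interior_subset hx
    rw [(hd x hx').deriv]
    exact vv_ge hc0 hc1 (by linarith [hx'.1]) (by linarith [hx'.2])
  · refine (convex_Icc s t).image_sub_le_mul_sub_of_deriv_le hcont hdiff ?_ s
      (Set.left_mem_Icc.2 hst) t (Set.right_mem_Icc.2 hst) hst
    intro x hx
    have hx' := interior_subset hx
    rw [(hd x hx').deriv]
    exact vv_le hc0 hc1 (by linarith [hx'.1]) (by linarith [hx'.2])

/-- key inequality: `A + B / f(t-h) ≤ f(t+h)`, cleared of denominators -/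
theorem key_ineq {c t h : ℝ} (hc0 : 0 < c) (hc1 : c ≤ 1) (hh : 0 ≤ h) (hth : h ≤ t)
    (ht1 : t + h ≤ 1/2) (hsmall : 3 * h ≤ c^6) :
    c * (1 - 2*t) * ff c (t-h) + t ≤ (1 - t) * (ff c (t+h) * ff c (t-h)) := by
  have hq := ff_quad hc0 hc1 (t := t) (by linarith) (by linarith)
  have g0 := ff_ge hc0 hc1 (t := t) (by linarith) (by linarith)
  have l0 := ff_le hc0 hc1 (t := t) (by linarith)
  have g1 := ff_ge hc0 hc1 (t := t-h) (by linarith) (by linarith)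
  have g2 := ff_ge hc0 hc1 (t := t+h) (by linarith) (by linarith)
  have hsd := second_diff hc0 hc1 hh hth ht1
  have hld := (log_ff_diff hc0 hc1 (s := t-h) (t := t) (by linarith) (by linarith) (by linarith)).1
  set f := ff c t
  set f1 := ff c (t-h)
  set f2 := ff c (t+h)
  have ha : 0 ≤ 1 - c^2 := by nlinarith
  set a := 1 - c^2
  have hf : 0 < f := by linarith
  have hf1 : 0 < f1 := by linarith
  have hf2 : 0 < f2 := by linarith
  -- f2 f1 ≥ f² (1 - K h²)
  have hA : f^2 * (1 - 3 * a * (1 - 2*t) / c^4 * h^2) ≤ f2 * f1 := by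
    have e1 : Real.log (f2 * f1 / f^2) = Real.log f2 + Real.log f1 - 2 * Real.log f := by
      rw [Real.log_div (by positivity) (by positivity), Real.log_mul hf2.ne' hf1.ne',
        Real.log_pow]; push_cast; ring
    have e2 := Real.log_le_sub_one_of_pos (x := f2 * f1 / f^2) (by positivity)
    have e3 : 1 - 3 * a * (1 - 2*t) / c^4 * h^2 ≤ f2 * f1 / f^2 := by linarith
    rw [le_div_iff₀ (by positivity)] at e3
    linarith
  -- f - f1 ≥ f1 a h
  have hB : c * (a * h) ≤ f - f1 := by
    have e1 : Real.log (f / f1) = Real.log f - Real.log f1 :=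
      Real.log_div hf.ne' hf1.ne'
    have e2 := Real.log_le_sub_one_of_pos (x := f / f1) (by positivity)
    have e3 : 1 + a * h ≤ f / f1 := by
      have : t - (t - h) = h := by ring
      rw [this] at hld
      linarith
    rw [le_div_iff₀ hf1] at e3
    have : c * (a*h) ≤ f1 * (a*h) := mul_le_mul_of_nonneg_right g1 (by positivity)
    linarith
  have hu : 0 ≤ 1 - 2*t := by linarith
  have hK : 3 * a * (1 - 2*t) / c^4 * h^2 ≤ c^2 * a * (1-2*t) * h := by
    rw [div_mul_eq_mul_div, div_le_iff₀ (by positivity)]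
    have : 0 ≤ a * (1-2*t) * h := by positivity
    nlinarith
  have hK0 : 0 ≤ c^2 * a * (1-2*t) * h := by positivity
  have hf2' : f^2 ≤ 1 := by nlinarith
  have hC : f^2 - c^2 * a * (1-2*t) * h ≤ f2 * f1 := by nlinarith
  have hD := mul_le_mul_of_nonneg_left hB (mul_nonneg hc0.le hu)
  have hE := mul_le_mul_of_nonneg_left hC (show 0 ≤ 1 - t by linarith)
  nlinarith

theorem interlace {β : ℝ} (hβ : 0 ≤ β) {m : ℕ} (hm : 0 < m)
    (hsmall : 3 / (m:ℝ) ≤ Real.exp (-2*β) ^ 6) (k : ℕ) (hk : 2 * (k+1) ≤ m) :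
    0 < gAux β m k ∧ ff (Real.exp (-2*β)) ((k:ℝ)/m) * gAux β m k ≤ gAux β m (k+1) ∧
      gAux β m (k+1) ≤ ff (Real.exp (-2*β)) (((k:ℝ)+1)/m) * gAux β m k := by
  have hm' : (0:ℝ) < m := by exact_mod_cast hm
  have hc0 := Real.exp_pos (-2*β)
  have hc1 : Real.exp (-2*β) ≤ 1 := Real.exp_le_one_iff.2 (by linarith)
  induction k with
  | zero =>
    have hk' : (2:ℝ) ≤ m := by exact_mod_cast (by omega : 2 ≤ m)
    have : ff (Real.exp (-2*β)) 0 = Real.exp (-2*β) := by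
      unfold ff SS
      have : (1 + (Real.exp (-2*β) ^ 2 - 1) * (1 - 2*0)^2) = Real.exp (-2*β)^2 := by ring
      rw [this, Real.sqrt_sq hc0.le]; ring
    refine ⟨by simp [gAux], ?_, ?_⟩
    · simp only [gAux, Nat.cast_zero, zero_div, this]; simp
    · simp only [gAux, Nat.cast_zero, zero_add, mul_one]
      apply ff_ge hc0 hc1 (by positivity)
      rw [div_le_div_iff₀ hm' (by norm_num)]; linarith
  | succ k ih =>
    obtain ⟨p, lo, hi⟩ := ih (by omega)
    have hk' : 2 * ((k:ℝ) + 2) ≤ m := by exact_mod_cast hk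
    set c := Real.exp (-2*β)
    set t : ℝ := ((k:ℝ)+1)/m with ht
    have hh : (0:ℝ) ≤ 1/m := by positivity
    have htm : t * m = (k:ℝ)+1 := by rw [ht]; field_simp
    have e1 : (k:ℝ)/m = t - 1/m := by rw [ht]; ring
    have e2 : (((k+1:ℕ):ℝ)+1)/m = t + 1/m := by rw [ht]; push_cast; ring
    have e3 : ((k+1:ℕ):ℝ)/m = t := by rw [ht]; push_cast; ring
    have h1 : 1/(m:ℝ) ≤ t := by
      rw [ht]; gcongr; linarith [(Nat.cast_nonneg k : (0:ℝ) ≤ k)]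
    have h2 : t + 1/m ≤ 1/2 := by
      rw [ht, ← add_div, div_le_div_iff₀ hm' (by norm_num)]; linarith
    have key := key_ineq hc0 hc1 hh h1 h2 (by rw [← mul_div_assoc, mul_one]; exact hsmall)
    have hq := ff_quad hc0 hc1 (t := t) (by linarith) (by linarith)
    have g0 := ff_ge hc0 hc1 (t := t) (by linarith) (by linarith)
    have g1 := ff_ge hc0 hc1 (t := t-1/m) (by linarith) (by linarith)
    rw [e1] at lo
    rw [e2, e3]
    set f := ff c t
    set f1 := ff c (t-1/m)
    set f2 := ff c (t+1/m)
    set G := gAux β m k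
    have hrec : (1-t) * gAux β m (k+1+1) = c * (1-2*t) * gAux β m (k+1) + t * G := by
      have : gAux β m (k+1+1) = (((m:ℝ) - 2*((k:ℝ)+2) + 2) * c / ((m:ℝ) - ((k:ℝ)+2) + 1)) *
        gAux β m (k+1) + (((k:ℝ)+1) / ((m:ℝ) - ((k:ℝ)+2) + 1)) * G := rfl
      rw [this]
      have d1 : (m:ℝ) - ((k:ℝ)+2) + 1 = m * (1-t) := by linear_combination htm
      have d2 : (m:ℝ) - 2*((k:ℝ)+2) + 2 = m * (1-2*t) := by linear_combination 2 * htm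
      have d3 : (1 - t) ≠ 0 := by linarith
      rw [d1, d2, ← htm]
      field_simp
    set G1 := gAux β m (k+1)
    have hG1 : 0 < G1 := lt_of_lt_of_le (mul_pos (by linarith) p) lo
    have ht0 : 0 ≤ t := by linarith
    have hf : 0 < f := by linarith
    have hf1 : 0 < f1 := by linarith
    have h1t : 0 < 1 - t := by linarith
    refine ⟨hG1, ?_, ?_⟩
    · have : (f * (1-t)) * (f * G1) ≤ (f * (1-t)) * gAux β m (k+1+1) := by
        have a1 : (f * (1-t)) * gAux β m (k+1+1) = f * (c * (1-2*t) * G1 + t * G) := by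
          rw [← hrec]; ring
        have a2 : (f * (1-t)) * (f * G1) = (c * (1 - 2*t) * f + t) * G1 := by rw [← hq]; ring
        rw [a1, a2]
        have := mul_le_mul_of_nonneg_left hi ht0
        linarith
      exact le_of_mul_le_mul_left this (by positivity)
    · have : (f1 * (1-t)) * gAux β m (k+1+1) ≤ (f1 * (1-t)) * (f2 * G1) := by
        have a1 : (f1 * (1-t)) * gAux β m (k+1+1) = f1 * (c * (1-2*t) * G1 + t * G) := by
          rw [← hrec]; ring
        rw [a1]
        have := mul_le_mul_of_nonneg_left lo ht0
        have := mul_le_mul_of_nonneg_right key hG1.le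
        linarith
      exact le_of_mul_le_mul_left this (by positivity)

theorem fIsing_eq (β t : ℝ) : fIsing β t = ff (Real.exp (-2*β)) t := rfl

theorem gIsing_eq (β : ℝ) {k m : ℕ} (hk : k ≤ m) : gIsing β k m = gAux β m (min k (m-k)) := by
  unfold gIsing
  split_ifs with h
  · rw [min_eq_left (by omega)]
  · rw [min_eq_right (by omega)]

theorem FIsing_eq_s12 (β : ℝ) {k m : ℕ} (hm : 0 < m) (hk : k ≤ m) :
    FIsing β ((k:ℝ)/m) =
      ∫ s in (0:ℝ)..(((min k (m-k) : ℕ):ℝ)/m), Real.log (ff (Real.exp (-2*β)) s) := by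
  have hm' : (0:ℝ) < m := by exact_mod_cast hm
  have : min ((k:ℝ)/m) (1 - (k:ℝ)/m) = ((min k (m-k) : ℕ):ℝ)/m := by
    have : 1 - (k:ℝ)/m = ((m - k : ℕ) : ℝ)/m := by
      rw [Nat.cast_sub hk]; field_simp
    rw [this, Nat.cast_min, min_div_div_right hm'.le]
  unfold FIsing
  rw [this]
  rfl

/-- the error on the half range -/
noncomputable def DD (β : ℝ) (m k : ℕ) : ℝ :=
  Real.log (gAux β m k) - m * ∫ s in (0:ℝ)..((k:ℝ)/m), Real.log (ff (Real.exp (-2*β)) s)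

theorem DD_step {β : ℝ} (hβ : 0 ≤ β) {m : ℕ} (hm : 0 < m)
    (hsmall : 3 / (m:ℝ) ≤ Real.exp (-2*β) ^ 6) (k : ℕ) (hk : 2 * (k+1) ≤ m) :
    |DD β m (k+1) - DD β m k| ≤ 1 / Real.exp (-2*β)^2 / m := by
  have hm' : (0:ℝ) < m := by exact_mod_cast hm
  have hc0 := Real.exp_pos (-2*β)
  have hc1 : Real.exp (-2*β) ≤ 1 := Real.exp_le_one_iff.2 (by linarith)
  obtain ⟨p, lo, hi⟩ := interlace hβ hm hsmall k hk
  unfold DD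
  have hk' : 2 * ((k:ℝ) + 1) ≤ m := by exact_mod_cast hk
  push_cast
  set c := Real.exp (-2*β)
  set s : ℝ := (k:ℝ)/m with hs
  set t : ℝ := ((k:ℝ)+1)/m with ht
  have hts : t - s = 1/m := by rw [ht, hs]; ring
  have hs0 : 0 ≤ s := by positivity
  have hst : s ≤ t := by
    have : (0:ℝ) ≤ 1/m := by positivity
    linarith
  have ht1 : t ≤ 1/2 := by rw [ht, div_le_div_iff₀ hm' (by norm_num)]; linarith
  have gs := ff_ge hc0 hc1 hs0 (by linarith)
  have gt := ff_ge hc0 hc1 (t := t) (by linarith) ht1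
  have ha : 0 ≤ 1 - c^2 := by nlinarith
  have hcont : ContinuousOn (fun s => Real.log (ff c s)) (Set.Icc 0 (1/2)) :=
    fun x hx => (hasDerivAt_log_ff hc0 hc1 hx.1 hx.2).continuousAt.continuousWithinAt
  have hint : ∀ a b : ℝ, 0 ≤ a → a ≤ b → b ≤ 1/2 →
      IntervalIntegrable (fun s => Real.log (ff c s)) volume a b := by
    intro a b h0 h1 h2
    apply ContinuousOn.intervalIntegrable_of_Icc h1
    exact hcont.mono (Set.Icc_subset_Icc h0 h2)
  have hmono : ∀ x y, 0 ≤ x → x ≤ y → y ≤ 1/2 → Real.log (ff c x) ≤ Real.log (ff c y) := by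
    intro x y h0 h1 h2
    have := (log_ff_diff hc0 hc1 h0 h1 h2).1
    have : 0 ≤ (1-c^2)*(y-x) := mul_nonneg ha (by linarith)
    linarith
  have hsplit := intervalIntegral.integral_add_adjacent_intervals
    (hint 0 s le_rfl hs0 (by linarith)) (hint s t hs0 hst ht1)
  have I1 : (t - s) * Real.log (ff c s) ≤ ∫ x in s..t, Real.log (ff c x) := by
    have := intervalIntegral.integral_mono_on hst (intervalIntegrable_const (c := Real.log (ff c s)))
      (hint s t hs0 hst ht1) (fun x hx => hmono s x hs0 hx.1 (by linarith [hx.2]))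
    simpa using this
  have I2 : (∫ x in s..t, Real.log (ff c x)) ≤ (t - s) * Real.log (ff c t) := by
    have := intervalIntegral.integral_mono_on hst (hint s t hs0 hst ht1)
      (intervalIntegrable_const (c := Real.log (ff c t)))
      (fun x hx => hmono x t (by linarith [hx.1]) hx.2 ht1)
    simpa using this
  have hup := (log_ff_diff hc0 hc1 hs0 hst ht1).2
  rw [hts] at I1 I2 hup
  have J1 := mul_le_mul_of_nonneg_left I1 hm'.le
  have J2 := mul_le_mul_of_nonneg_left I2 hm'.le
  rw [← mul_assoc, mul_one_div_cancel hm'.ne', one_mul] at J1 J2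
  have fs : 0 < ff c s := by linarith
  have ft : 0 < ff c t := by linarith
  have p1 : 0 < gAux β m (k+1) := lt_of_lt_of_le (mul_pos fs p) lo
  have L1 := Real.log_le_log (mul_pos fs p) lo
  have L2 := Real.log_le_log p1 hi
  rw [Real.log_mul fs.ne' p.ne'] at L1
  rw [Real.log_mul ft.ne' p.ne'] at L2
  rw [← hsplit]
  have hup' : Real.log (ff c t) - Real.log (ff c s) ≤ 1 / c^2 / m := by
    rw [mul_one_div] at hup; exact hup
  rw [abs_le]
  constructor <;> nlinarith

theorem DD_le {β : ℝ} (hβ : 0 ≤ β) {m : ℕ} (hm : 0 < m)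
    (hsmall : 3 / (m:ℝ) ≤ Real.exp (-2*β) ^ 6) (k n : ℕ) (hk : 2 * (k+n) ≤ m) :
    |DD β m (k+n) - DD β m k| ≤ 1 / Real.exp (-2*β)^2 / m * n := by
  induction n with
  | zero => simp
  | succ n ih =>
    have h1 := ih (by omega)
    have h2 := DD_step hβ hm hsmall (k+n) (by omega)
    have h3 := abs_sub_le (DD β m (k+(n+1))) (DD β m (k+n)) (DD β m k)
    rw [← add_assoc] at *
    push_cast
    linarith

theorem DD_abs {β : ℝ} (hβ : 0 ≤ β) {m : ℕ} (hm : 0 < m)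
    (hsmall : 3 / (m:ℝ) ≤ Real.exp (-2*β) ^ 6) (k l : ℕ) (hk : 2 * k ≤ m) (hl : 2 * l ≤ m) :
    |DD β m k - DD β m l| ≤ 1 / Real.exp (-2*β)^2 / m * |(k:ℝ) - l| := by
  rcases le_total k l with h | h
  · obtain ⟨n, rfl⟩ := Nat.exists_eq_add_of_le h
    have := DD_le hβ hm hsmall k n hl
    rw [abs_sub_comm]
    have e : |(k:ℝ) - (k+n:ℕ)| = n := by
      push_cast; rw [sub_add_cancel_left, abs_neg, Nat.abs_cast]
    rw [e]; exact this
  · obtain ⟨n, rfl⟩ := Nat.exists_eq_add_of_le h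
    have := DD_le hβ hm hsmall l n hk
    have e : |((l+n:ℕ):ℝ) - l| = n := by
      push_cast; rw [add_sub_cancel_left, Nat.abs_cast]
    rw [e]; exact this

/-- Key lemma, part (i): uniform Lipschitz-type control of
`log g(β,k,m) − m F(β,k/m)` in `k`. -/
theorem g_F_lipschitz (β : ℝ) (hβ : 0 ≤ β) :
    ∃ C : ℝ, 0 < C ∧ ∀ᶠ m : ℕ in Filter.atTop, ∀ k ℓ : ℕ, k ≤ ℓ → ℓ ≤ m →
      |(Real.log (gIsing β k m) - (m:ℝ) * FIsing β ((k:ℝ)/(m:ℝ)))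
        - (Real.log (gIsing β ℓ m) - (m:ℝ) * FIsing β ((ℓ:ℝ)/(m:ℝ)))|
        ≤ C * |(k:ℝ) - (ℓ:ℝ)| / (m:ℝ) := by
  have hc0 := Real.exp_pos (-2*β)
  refine ⟨1 / Real.exp (-2*β)^2, by positivity, ?_⟩
  have hev : ∀ᶠ m : ℕ in Filter.atTop, 3 / (m:ℝ) ≤ Real.exp (-2*β) ^ 6 :=
    (tendsto_const_div_atTop_nhds_zero_nat 3).eventually_le_const (by positivity)
  filter_upwards [hev, Filter.eventually_gt_atTop 0] with m hsmall hm k l hkl hlm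
  have hm' : (0:ℝ) < m := by exact_mod_cast hm
  rw [gIsing_eq β (hkl.trans hlm), gIsing_eq β hlm, FIsing_eq_s12 β hm (hkl.trans hlm),
    FIsing_eq_s12 β hm hlm]
  have h := DD_abs hβ hm hsmall (min k (m-k)) (min l (m-l)) (by omega) (by omega)
  have hd : |((min k (m-k) : ℕ):ℝ) - ((min l (m-l) : ℕ):ℝ)| ≤ |(k:ℝ) - l| := by
    have : |((min k (m-k) : ℕ):ℤ) - ((min l (m-l) : ℕ):ℤ)| ≤ |(k:ℤ) - l| := by
      rw [abs_le]
      rw [abs_of_nonpos (by omega : (k:ℤ) - l ≤ 0)]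
      constructor <;> omega
    exact_mod_cast this
  unfold DD at h
  refine h.trans ?_
  rw [div_mul_eq_mul_div]
  gcongr
end
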